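/- arXiv:2605.21107 — 6 statements merged into one kernel-verified Lean document; each statement's English description precedes it below -/
import Mathlib

section
/- Fix a dimension d ≥ 1. There exists a constant C > 0 depending only on d such that the following holds. Let T ≥ 1, let K_0 ⊇ K_1 ⊇ ⋯ ⊇ K_T be a nested sequence of nonempty closed convex subsets of Euclidean space ℝ^d with diam(K_0) ≤ D, let x_1 ∈ K_0, let e_1, …, e_T ∈ ℝ^d be arbitrary vectors, and define iterates by x_{t+1} = Π_{K_t}(x_t − e_t) for 1 ≤ t ≤ T. Then the total movement satisfies Σ_{t=1}^{T} ‖x_{t+1} − x_t‖ ≤ C · (D + Σ_{t=1}^{T} ‖e_t‖), where ‖·‖ is the Euclidean norm. -/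
open scoped RealInnerProductSpace

section

variable {E : Type*} [NormedAddCommGroup E] [InnerProductSpace ℝ E]

/-- In finite dimension, unit vectors with pairwise almost nonnegative inner products all lie in an
open half-space cut out, with a uniform margin, by one of finitely many fixed vectors. -/
lemma exists_finset_forall_le_inner (E : Type*) [NormedAddCommGroup E] [InnerProductSpace ℝ E]
    [FiniteDimensional ℝ E] :
    ∃ (ε : ℝ) (N : Finset E), 0 < ε ∧ ε ≤ 1 ∧ ∀ V : Set E, (∀ v ∈ V, ‖v‖ = 1) →
      (∀ u ∈ V, ∀ v ∈ V, -ε ≤ ⟪u, v⟫) → ∃ w ∈ N, ∀ v ∈ V, 1 / 8 ≤ ⟪v, w⟫ := by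
  classical
  have : ProperSpace E := FiniteDimensional.proper ℝ E
  obtain ⟨F', -, hF'fin, hF'⟩ :=
    (isCompact_sphere (0 : E) 1).finite_cover_balls (e := 1 / 2) (by norm_num)
  lift F' to Finset E using hF'fin with F
  obtain ⟨N', -, hN'fin, hN'⟩ :=
    (isCompact_closedBall (0 : E) (F.card : ℝ)).finite_cover_balls (e := 1 / 8) (by norm_num)
  lift N' to Finset E using hN'fin with N
  have hcard : (0 : ℝ) < 4 * (F.card + 1) := by positivity
  refine ⟨1 / (4 * (F.card + 1)), N, by positivity, ?_, ?_⟩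
  · rw [div_le_one hcard]
    linarith [(Nat.cast_nonneg F.card : (0 : ℝ) ≤ F.card)]
  intro V hV hVV
  set ε : ℝ := 1 / (4 * (F.card + 1)) with hε
  have hε0 : 0 < ε := by positivity
  have hεF : F.card * ε ≤ 1 / 4 := by
    rw [hε, mul_one_div, div_le_div_iff₀ hcard (by norm_num)]
    linarith
  have hr : ∀ p : E, ∃ q : E, (q ∈ V ∨ q = 0) ∧
      ((∃ v ∈ V, dist v p < 1 / 2) → q ∈ V ∧ dist q p < 1 / 2) := by
    intro p
    by_cases h : ∃ v ∈ V, dist v p < 1 / 2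
    · obtain ⟨v, hv, hvp⟩ := h
      exact ⟨v, Or.inl hv, fun _ => ⟨hv, hvp⟩⟩
    · exact ⟨0, Or.inr rfl, fun h' => absurd h' h⟩
  choose r hr0 hr1 using hr
  have hnorm : ‖∑ p ∈ F, r p‖ ≤ F.card := by
    refine (norm_sum_le_of_le F (f := r) (n := fun _ => (1 : ℝ)) fun p _ => ?_).trans (by simp)
    rcases hr0 p with h | h
    · exact (hV _ h).le
    · simp [h]
  have hmem : ∑ p ∈ F, r p ∈ Metric.closedBall (0 : E) (F.card : ℝ) := by simpa using hnorm
  obtain ⟨w, hwN, hw⟩ := Set.mem_iUnion₂.1 (hN' hmem)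
  refine ⟨w, hwN, fun v hv => ?_⟩
  have hsph : v ∈ Metric.sphere (0 : E) 1 := by simpa using hV v hv
  obtain ⟨p₀, hp₀, hvp₀⟩ := Set.mem_iUnion₂.1 (hF' hsph)
  have hp₀F : p₀ ∈ F := hp₀
  obtain ⟨hrV, hrp⟩ := hr1 p₀ ⟨v, hv, hvp₀⟩
  have hlow : ∀ p, -ε ≤ ⟪v, r p⟫ := by
    intro p
    rcases hr0 p with h | h
    · exact hVV v hv _ h
    · simp [h, hε0.le]
  have hnear : 1 / 2 ≤ ⟪v, r p₀⟫ := by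
    have h1 : ‖v - r p₀‖ < 1 := by
      rw [← dist_eq_norm]
      have := dist_triangle_right v (r p₀) p₀
      have h3 : dist v p₀ < 1 / 2 := hvp₀
      linarith
    have h2 := norm_sub_sq_real v (r p₀)
    rw [hV v hv, hV _ hrV] at h2
    nlinarith [norm_nonneg (v - r p₀)]
  have hsum : 1 / 4 ≤ ⟪v, ∑ p ∈ F, r p⟫ := by
    rw [inner_sum, ← Finset.add_sum_erase F _ hp₀F]
    have h1 : ∑ p ∈ F.erase p₀, (-ε) ≤ ∑ p ∈ F.erase p₀, ⟪v, r p⟫ :=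
      Finset.sum_le_sum fun p _ => hlow p
    have h2 : ((F.erase p₀).card : ℝ) ≤ F.card := by
      exact_mod_cast Finset.card_le_card (Finset.erase_subset _ _)
    rw [Finset.sum_const, nsmul_eq_mul] at h1
    nlinarith
  have hround : ⟪v, ∑ p ∈ F, r p⟫ - ⟪v, w⟫ ≤ 1 / 8 := by
    rw [← inner_sub_right]
    refine (real_inner_le_norm _ _).trans ?_
    rw [hV v hv, one_mul, ← dist_eq_norm]
    exact (show dist (∑ p ∈ F, r p) w < 1 / 8 from hw).le
  linarith

/-- If every positive `g t` is a gap below all later values of one of finitely many functions with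
values in `[L, U]`, then `∑ g ≤ |N| (U - L)`. -/
lemma sum_le_card_mul_of_forall_exists_gap {ι : Type*} (N : Finset ι) (f : ι → ℕ → ℝ) (g : ℕ → ℝ)
    (n : ℕ) {L U : ℝ} (hL : ∀ w ∈ N, ∀ s ≤ n, L ≤ f w s) (hU : ∀ w ∈ N, ∀ s ≤ n, f w s ≤ U)
    (hg : ∀ t < n, g t ≤ 0 ∨ ∃ w ∈ N, ∀ s, t < s → s ≤ n → f w t + g t ≤ f w s) :
    ∑ t ∈ Finset.range n, g t ≤ N.card * (U - L) := by
  classical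
  have hpart : ∀ w ∈ N, ∀ k ≤ n, ∀ s, k ≤ s → s ≤ n →
      ∑ t ∈ Finset.range k,
        (if ∀ s, t < s → s ≤ n → f w t + g t ≤ f w s then max (g t) 0 else 0) ≤ f w s - L := by
    intro w hw k
    induction k with
    | zero => intro _ s _ hs; simpa using hL w hw s hs
    | succ k ih =>
      intro hk s hks hs
      rw [Finset.sum_range_succ]
      split_ifs with h
      · have h1 := ih (by omega) k le_rfl (by omega)
        have h2 := ih (by omega) s (by omega) hs
        have h3 := h s (by omega) hs
        rcases max_cases (g k) 0 with h4 | h4 <;> linarith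
      · simpa using ih (by omega) s (by omega) hs
  have hterm : ∀ t ∈ Finset.range n, g t ≤ ∑ w ∈ N,
      (if ∀ s, t < s → s ≤ n → f w t + g t ≤ f w s then max (g t) 0 else 0) := by
    intro t ht
    have hnn : ∀ w ∈ N,
        0 ≤ (if ∀ s, t < s → s ≤ n → f w t + g t ≤ f w s then max (g t) 0 else 0) := by
      intro w _
      split_ifs
      · exact le_max_right _ _
      · exact le_rfl
    rcases hg t (Finset.mem_range.1 ht) with h | ⟨w, hw, h⟩
    · exact h.trans (Finset.sum_nonneg hnn)
    · refine le_trans ?_ (Finset.single_le_sum hnn hw)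
      rw [if_pos h]
      exact le_max_left _ _
  refine (Finset.sum_le_sum hterm).trans ?_
  rw [Finset.sum_comm, ← nsmul_eq_mul]
  refine Finset.sum_le_card_nsmul _ _ _ fun w hw => ?_
  linarith [hpart w hw n le_rfl n le_rfl le_rfl, hU w hw n le_rfl]

/-- Perturbed projections onto nested sets do not move away from later iterates by more than the
accumulated perturbation. -/
lemma norm_sub_le_add_sum_of_perturbed_projection {x e : ℕ → E} {T : ℕ}
    (hproj : ∀ t < T, ∀ s, t < s → s ≤ T → ⟪(x t - e t) - x (t + 1), x s - x (t + 1)⟫ ≤ 0)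
    {t s r : ℕ} (hts : t ≤ s) (hsr : s ≤ r) (hr : r ≤ T) :
    ‖x s - x r‖ ≤
      ‖x t - x r‖ + (∑ i ∈ Finset.range s, ‖e i‖ - ∑ i ∈ Finset.range t, ‖e i‖) := by
  induction s, hts using Nat.le_induction with
  | base => simp
  | succ s hts ih =>
    have h1 := ih (by omega)
    have h2 := hproj s (by omega) r (by omega) hr
    have h3 : ‖x (s + 1) - x r‖ ≤ ‖x s - e s - x r‖ := by
      have h4 : x s - e s - x r = (x s - e s - x (s + 1)) - (x r - x (s + 1)) := by abel
      have h5 := norm_sub_sq_real (x s - e s - x (s + 1)) (x r - x (s + 1))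
      rw [← h4] at h5
      rw [norm_sub_rev]
      refine (sq_le_sq₀ (norm_nonneg _) (norm_nonneg _)).1 ?_
      nlinarith [sq_nonneg ‖x s - e s - x (s + 1)‖]
    have h6 : ‖x s - e s - x r‖ ≤ ‖x s - x r‖ + ‖e s‖ := by
      rw [sub_right_comm]
      exact norm_sub_le _ _
    rw [Finset.sum_range_succ]
    linarith

/-- A vector `v` on the far side of a perturbed projection step `a` is at least half as long
as `a`, when the perturbation is small. -/
lemma half_norm_le_of_perturbed_projection {a e v : E} (he : 4 * ‖e‖ < ‖a‖)
    (h : ⟪-e - a, v - a⟫ ≤ 0) : ‖a‖ / 2 ≤ ‖v‖ := by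
  have h1 : ⟪-e - a, v - a⟫ = -⟪a + e, v⟫ + ⟪e, a⟫ + ‖a‖ ^ 2 := by
    rw [← real_inner_self_eq_norm_sq]
    simp only [inner_sub_left, inner_sub_right, inner_add_left, inner_neg_left]
    ring
  have h2 := neg_le_of_abs_le (abs_real_inner_le_norm e a)
  have h3 := real_inner_le_norm (a + e) v
  have h4 := norm_add_le a e
  have h5 := norm_nonneg e
  have h6 := norm_nonneg v
  by_contra! h7
  nlinarith

lemma neg_mul_le_inner_of_norm_sub_le {u v : E} {c ε : ℝ} (hc : 0 ≤ c) (hε : ε ≤ 1)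
    (hcu : c ≤ ε * ‖u‖) (h : ‖u - v‖ ≤ ‖v‖ + c) : -(ε * (‖u‖ * ‖v‖)) ≤ ⟪u, v⟫ := by
  have h1 := norm_sub_sq_real u v
  have h2 : ‖u - v‖ ^ 2 ≤ (‖v‖ + c) ^ 2 := pow_le_pow_left₀ (norm_nonneg _) h 2
  have hu := norm_nonneg u
  have hv := norm_nonneg v
  have h3 : c ≤ ‖u‖ := by nlinarith
  nlinarith [mul_le_mul_of_nonneg_right hcu hv, pow_le_pow_left₀ hc h3 2]

lemma exists_sum_norm_sub_le_of_perturbed_projection (E : Type*) [NormedAddCommGroup E]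
    [InnerProductSpace ℝ E] [FiniteDimensional ℝ E] :
    ∃ C : ℝ, 0 < C ∧ ∀ (T : ℕ) (D : ℝ) (x e : ℕ → E), 0 ≤ D →
      (∀ s ≤ T, ‖x s - x 0‖ ≤ D) →
      (∀ t < T, ∀ s, t < s → s ≤ T → ⟪(x t - e t) - x (t + 1), x s - x (t + 1)⟫ ≤ 0) →
      ∑ t ∈ Finset.range T, ‖x (t + 1) - x t‖ ≤ C * (D + ∑ t ∈ Finset.range T, ‖e t‖) := by
  obtain ⟨ε, N, hε0, hε1, hN⟩ := exists_finset_forall_le_inner E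
  obtain ⟨B, hB0, hB⟩ : ∃ B : ℝ, 0 ≤ B ∧ ∀ w ∈ N, ‖w‖ ≤ B :=
    ⟨∑ w ∈ N, ‖w‖, by positivity,
      fun w hw => Finset.single_le_sum (f := fun w : E => ‖w‖) (fun _ _ => norm_nonneg _) hw⟩
  set l : ℝ := (B + 1) / ε with hl
  have hl0 : 0 ≤ l := by positivity
  have hlε : l * ε = B + 1 := div_mul_cancel₀ _ hε0.ne'
  refine ⟨4 + 16 * (N.card * (2 * B + l)), by positivity, ?_⟩
  intro T D x e hD hx hproj
  set S : ℕ → ℝ := fun s => ∑ i ∈ Finset.range s, ‖e i‖ with hS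
  have hSmono : Monotone S := fun a b hab =>
    Finset.sum_le_sum_of_subset_of_nonneg (Finset.range_mono hab) fun _ _ _ => norm_nonneg _
  have hS0 : ∀ s, 0 ≤ S s := fun s => Finset.sum_nonneg fun _ _ => norm_nonneg _
  have hin : ∀ w ∈ N, ∀ y : E, |⟪y, w⟫| ≤ B * ‖y‖ := fun w hw y =>
    (abs_real_inner_le_norm y w).trans (by nlinarith [hB w hw, norm_nonneg y])
  have key := sum_le_card_mul_of_forall_exists_gap N (fun w s => ⟪x s - x 0, w⟫ + l * S s)
    (fun t => (‖x (t + 1) - x t‖ - 4 * ‖e t‖) / 16) T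
    (L := -(B * D)) (U := B * D + l * S T) ?_ ?_ ?_
  · rw [← Finset.sum_div, Finset.sum_sub_distrib, ← Finset.mul_sum] at key
    change _ ≤ _ * (D + S T)
    change (_ - 4 * S T) / 16 ≤ _ at key
    have h1 : (N.card : ℝ) * (B * D + l * S T - -(B * D)) ≤
        N.card * (2 * B + l) * (D + S T) := by
      rw [mul_assoc]
      refine mul_le_mul_of_nonneg_left ?_ (Nat.cast_nonneg _)
      nlinarith [mul_nonneg hB0 (hS0 T), mul_nonneg hl0 hD]
    linarith
  · intro w hw s hs
    have h1 := neg_le_of_abs_le (hin w hw (x s - x 0))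
    have h2 := mul_le_mul_of_nonneg_left (hx s hs) hB0
    have h3 := mul_nonneg hl0 (hS0 s)
    linarith
  · intro w hw s hs
    have h1 := le_of_abs_le (hin w hw (x s - x 0))
    have h2 := mul_le_mul_of_nonneg_left (hx s hs) hB0
    have h3 := mul_le_mul_of_nonneg_left (hSmono hs) hl0
    linarith
  intro t ht
  rcases le_or_gt ‖x (t + 1) - x t‖ (4 * ‖e t‖) with hsmall | hbig
  · left
    linarith
  right
  set m := ‖x (t + 1) - x t‖ with hm
  have hm0 : 0 < m := by linarith [norm_nonneg (e t)]
  have hfar : ∀ s, t < s → s ≤ T → m / 2 ≤ ‖x s - x t‖ := by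
    intro s hts hs
    refine half_norm_le_of_perturbed_projection hbig ?_
    convert hproj t ht s hts hs using 2 <;> abel
  have hpair : ∀ s r, t < s → s ≤ r → r ≤ T → S s - S t ≤ ε * ‖x s - x t‖ →
      -(ε * (‖x s - x t‖ * ‖x r - x t‖)) ≤ ⟪x s - x t, x r - x t⟫ := by
    intro s r hts hsr hr hs
    refine neg_mul_le_inner_of_norm_sub_le (sub_nonneg.2 (hSmono hts.le)) hε1 hs ?_
    rw [sub_sub_sub_cancel_right, norm_sub_rev (x r) (x t)]
    exact norm_sub_le_add_sum_of_perturbed_projection hproj hts.le hsr hr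
  have hpair' : ∀ s r, t < s → s ≤ T → t < r → r ≤ T → S s - S t ≤ ε * ‖x s - x t‖ →
      S r - S t ≤ ε * ‖x r - x t‖ →
      -(ε * (‖x s - x t‖ * ‖x r - x t‖)) ≤ ⟪x s - x t, x r - x t⟫ := by
    intro s r hts hs htr hr h1 h2
    rcases le_total s r with h | h
    · exact hpair s r hts h hr h1
    · rw [real_inner_comm, mul_comm ‖x s - x t‖]
      exact hpair r s htr h hs h2
  obtain ⟨w, hwN, hw⟩ : ∃ w ∈ N, ∀ v ∈ {v | ∃ s, t < s ∧ s ≤ T ∧ S s - S t ≤ ε * ‖x s - x t‖ ∧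
      v = ‖x s - x t‖⁻¹ • (x s - x t)}, 1 / 8 ≤ ⟪v, w⟫ := by
    apply hN
    · rintro v ⟨s, hts, hs, -, rfl⟩
      have hpos : 0 < ‖x s - x t‖ := by linarith [hfar s hts hs]
      rw [norm_smul, norm_inv, norm_norm, inv_mul_cancel₀ hpos.ne']
    · rintro u ⟨s, hts, hs, hsG, rfl⟩ v ⟨r, htr, hr, hrG, rfl⟩
      have hspos : 0 < ‖x s - x t‖ := by linarith [hfar s hts hs]
      have hrpos : 0 < ‖x r - x t‖ := by linarith [hfar r htr hr]
      have h1 := hpair' s r hts hs htr hr hsG hrG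
      rw [real_inner_smul_left, real_inner_smul_right, ← mul_assoc, ← mul_inv, inv_mul_eq_div,
        le_div_iff₀ (mul_pos hspos hrpos)]
      linarith
  refine ⟨w, hwN, fun s hts hs => ?_⟩
  have hf := hfar s hts hs
  have hpos : 0 < ‖x s - x t‖ := by linarith
  have hsplit : ⟪x s - x 0, w⟫ = ⟪x t - x 0, w⟫ + ⟪x s - x t, w⟫ := by
    rw [← inner_add_left, sub_add_sub_cancel']
  have hen := norm_nonneg (e t)
  have hmon := mul_le_mul_of_nonneg_left (hSmono hts.le) hl0
  change ⟪x t - x 0, w⟫ + l * S t + (m - 4 * ‖e t‖) / 16 ≤ ⟪x s - x 0, w⟫ + l * S s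
  rw [hsplit]
  by_cases hG : S s - S t ≤ ε * ‖x s - x t‖
  · have h1 := hw _ ⟨s, hts, hs, hG, rfl⟩
    rw [real_inner_smul_left, inv_mul_eq_div, le_div_iff₀ hpos] at h1
    linarith
  · have h1 := neg_le_of_abs_le (hin w hwN (x s - x t))
    have h2 := mul_le_mul_of_nonneg_left (not_le.1 hG).le hl0
    rw [← mul_assoc, hlε] at h2
    linarith

end

/-- Perturbed nested projection movement bound (Lemma 3 of the paper). -/
theorem perturbed_nested_projection_movement_bound (d : ℕ) (hd : 1 ≤ d) :
    ∃ C : ℝ, 0 < C ∧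
      ∀ (T : ℕ), 1 ≤ T →
      ∀ (D : ℝ), 0 ≤ D →
      ∀ (K : ℕ → Set (EuclideanSpace ℝ (Fin d)))
        (x e : ℕ → EuclideanSpace ℝ (Fin d)),
        (∀ t, t ≤ T → (K t).Nonempty) →
        (∀ t, t ≤ T → IsClosed (K t)) →
        (∀ t, t ≤ T → Convex ℝ (K t)) →
        (∀ t, t < T → K (t + 1) ⊆ K t) →
        (∀ u ∈ K 0, ∀ v ∈ K 0, ‖u - v‖ ≤ D) →
        x 1 ∈ K 0 →
        (∀ t, 1 ≤ t → t ≤ T → x (t + 1) ∈ K t ∧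
          ∀ y ∈ K t, ⟪(x t - e t) - x (t + 1), y - x (t + 1)⟫ ≤ 0) →
        ∑ t ∈ Finset.Icc 1 T, ‖x (t + 1) - x t‖ ≤
          C * (D + ∑ t ∈ Finset.Icc 1 T, ‖e t‖) := by
  obtain ⟨C, hC, h⟩ :=
    exists_sum_norm_sub_le_of_perturbed_projection (EuclideanSpace ℝ (Fin d))
  refine ⟨C, hC, fun T _ D hD K x e _ _ _ hK hdiam hx1 hx => ?_⟩
  have hanti : ∀ t s, t ≤ s → s ≤ T → K s ⊆ K t := by
    intro t s hts
    induction s, hts using Nat.le_induction with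
    | base => exact fun _ => subset_rfl
    | succ s _ ih => exact fun hs => (hK s (by omega)).trans (ih (by omega))
  have hmem : ∀ t s, t ≤ s → 1 ≤ s → s ≤ T → x (s + 1) ∈ K t := fun t s hts hs1 hs =>
    hanti t s hts hs (hx s hs1 hs).1
  have hsum : ∀ f : ℕ → ℝ, ∑ t ∈ Finset.Icc 1 T, f t = ∑ t ∈ Finset.range T, f (t + 1) := by
    intro f
    rw [Finset.range_eq_Ico, Finset.sum_Ico_add' f 0 T 1, zero_add]
    rfl
  rw [hsum, hsum]
  refine h T D (fun t => x (t + 1)) (fun t => e (t + 1)) hD (fun s hs => ?_) ?_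
  · refine hdiam _ ?_ _ hx1
    rcases Nat.eq_zero_or_pos s with rfl | hs0
    · exact hx1
    · exact hmem 0 s (Nat.zero_le _) hs0 hs
  · intro t ht s hts hs
    exact (hx (t + 1) (by omega) (by omega)).2 _ (hmem (t + 1) s hts (by omega) hs)
end

section
/- Fix a dimension d ≥ 1. There exists a constant C > 0 depending only on d such that the following holds. Let K_0 ⊇ K_1 ⊇ ⋯ ⊇ K_T be a nested sequence of nonempty closed convex subsets of ℝ^d with diam(K_0) ≤ D, let x_1 ∈ K_0, and define x_{t+1} = Π_{K_t}(x_t) for 1 ≤ t ≤ T. Then Σ_{t=1}^{T} ‖x_{t+1} − x_t‖ ≤ C · D, where ‖·‖ is the Euclidean norm. In particular, the total movement of the unperturbed nested projection curve is bounded independently of T. -/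
open scoped RealInnerProductSpace

section SelfContracted

variable {E : Type*} [NormedAddCommGroup E] [InnerProductSpace ℝ E]

/-- Finitely many vectors suffice to be uniformly positive on every family of unit vectors of a
finite-dimensional space with pairwise nonnegative inner products. -/
theorem exists_finset_quarter_le_inner_of_norm_eq_one [FiniteDimensional ℝ E] :
    ∃ W : Finset E, ∀ U : Set E, (∀ u ∈ U, ‖u‖ = 1) → (∀ u ∈ U, ∀ v ∈ U, 0 ≤ ⟪u, v⟫) →
      ∃ w ∈ W, ∀ u ∈ U, 1 / 4 ≤ ⟪w, u⟫ := by
  classical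
  obtain ⟨A, -, hA, hcovA⟩ := (isCompact_sphere (0 : E) 1).finite_cover_balls
    (show (0 : ℝ) < 1 / 2 by norm_num)
  lift A to Finset E using hA
  obtain ⟨W, -, hW, hcovW⟩ := (isCompact_closedBall (0 : E) A.card).finite_cover_balls
    (show (0 : ℝ) < 1 / 4 by norm_num)
  lift W to Finset E using hW
  refine ⟨W, fun U hU1 hU => ?_⟩
  let B : Finset E := A.filter fun a => ∃ u ∈ U, dist u a < 1 / 2
  have hB : ∀ a : E, ∃ u, a ∈ B → u ∈ U ∧ dist u a < 1 / 2 := by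
    intro a
    by_cases ha : a ∈ B
    · obtain ⟨u, hu⟩ := (Finset.mem_filter.1 ha).2
      exact ⟨u, fun _ => hu⟩
    · exact ⟨0, fun h => absurd h ha⟩
  choose g hg using hB
  have hnorm : ‖∑ a ∈ B, g a‖ ≤ A.card := by
    calc ‖∑ a ∈ B, g a‖ ≤ ∑ a ∈ B, ‖g a‖ := norm_sum_le _ _
      _ = B.card := by
        rw [Finset.sum_congr rfl fun a ha => hU1 _ (hg a ha).1]
        simp
      _ ≤ A.card := by exact_mod_cast Finset.card_filter_le _ _
  obtain ⟨w, hw, hwd⟩ := Set.mem_iUnion₂.1 (hcovW (mem_closedBall_zero_iff.2 hnorm))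
  refine ⟨w, hw, fun u hu => ?_⟩
  obtain ⟨a, ha, hua⟩ := Set.mem_iUnion₂.1 (hcovA (mem_sphere_zero_iff_norm.2 (hU1 u hu)))
  have haB : a ∈ B := Finset.mem_filter.2 ⟨ha, u, hu, hua⟩
  have hsum : 1 / 2 ≤ ⟪∑ a ∈ B, g a, u⟫ := by
    rw [sum_inner]
    refine le_trans ?_ (Finset.single_le_sum (f := fun b => ⟪g b, u⟫)
      (fun b hb => hU _ (hg b hb).1 _ hu) haB)
    have hclose : ‖g a - u‖ < 1 := by
      rw [← dist_eq_norm]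
      have h1 := dist_triangle_right (g a) u a
      have h2 := (hg a haB).2
      rw [Metric.mem_ball] at hua
      linarith
    have hsq := norm_sub_sq_real (g a) u
    rw [hU1 _ (hg a haB).1, hU1 u hu] at hsq
    have := norm_nonneg (g a - u)
    show 1 / 2 ≤ ⟪g a, u⟫
    nlinarith
  have herr : ⟪(∑ a ∈ B, g a) - w, u⟫ ≤ 1 / 4 := by
    refine (real_inner_le_norm _ _).trans ?_
    rw [hU1 u hu, mul_one, ← dist_eq_norm]
    exact (Metric.mem_ball.1 hwd).le
  rw [inner_sub_left] at herr
  linarith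

/-- Finitely many vectors suffice to be uniformly positive on every family of vectors of a
finite-dimensional space with pairwise nonnegative inner products. -/
theorem exists_finset_quarter_norm_le_inner [FiniteDimensional ℝ E] :
    ∃ W : Finset E, ∀ U : Set E, (∀ u ∈ U, ∀ v ∈ U, 0 ≤ ⟪u, v⟫) →
      ∃ w ∈ W, ∀ u ∈ U, 1 / 4 * ‖u‖ ≤ ⟪w, u⟫ := by
  obtain ⟨W, hW⟩ := exists_finset_quarter_le_inner_of_norm_eq_one (E := E)
  refine ⟨W, fun U hU => ?_⟩
  obtain ⟨w, hw, hwU⟩ := hW ((fun u => ‖u‖⁻¹ • u) '' (U \ {0})) (by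
    rintro _ ⟨u, hu, rfl⟩
    exact norm_smul_inv_norm (𝕜 := ℝ) hu.2) (by
    rintro _ ⟨u, hu, rfl⟩ _ ⟨v, hv, rfl⟩
    rw [real_inner_smul_left, real_inner_smul_right]
    have := hU u hu.1 v hv.1
    positivity)
  refine ⟨w, hw, fun u hu => ?_⟩
  rcases eq_or_ne u 0 with rfl | hu0
  · simp
  have h := hwU _ ⟨u, ⟨hu, hu0⟩, rfl⟩
  rw [real_inner_smul_right, inv_mul_eq_div, le_div_iff₀ (norm_pos_iff.2 hu0)] at h
  exact h

theorem norm_sub_le_norm_sub_of_inner_nonpos {a b p : E} (h : ⟪a - b, p - b⟫ ≤ 0) :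
    ‖b - p‖ ≤ ‖a - p‖ := by
  have hsq := norm_sub_sq_real (a - b) (p - b)
  rw [sub_sub_sub_cancel_right, norm_sub_rev p b] at hsq
  refine le_of_sq_le_sq ?_ (norm_nonneg _)
  nlinarith [sq_nonneg ‖a - b‖]

/-- Along a sequence each of whose steps makes an obtuse angle with all later points, the
distance to a fixed point is nonincreasing until that point is reached. -/
theorem norm_sub_le_norm_sub_of_step_inner_nonpos {y : ℕ → E}
    (hy : ∀ t s, t < s → ⟪y t - y (t + 1), y s - y (t + 1)⟫ ≤ 0)
    {t s r : ℕ} (hts : t ≤ s) (hsr : s ≤ r) : ‖y s - y r‖ ≤ ‖y t - y r‖ := by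
  induction s, hts using Nat.le_induction with
  | base => exact le_rfl
  | succ s _ ih =>
    exact (norm_sub_le_norm_sub_of_inner_nonpos (hy s r hsr)).trans (ih (by lia))

/-- The directions from a point of the sequence to the later points pairwise make acute angles. -/
theorem inner_sub_nonneg_of_step_inner_nonpos {y : ℕ → E}
    (hy : ∀ t s, t < s → ⟪y t - y (t + 1), y s - y (t + 1)⟫ ≤ 0)
    {t s r : ℕ} (hts : t ≤ s) (htr : t ≤ r) : 0 ≤ ⟪y s - y t, y r - y t⟫ := by
  wlog hsr : s ≤ r generalizing s r
  · rw [real_inner_comm]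
    exact this htr hts (by lia)
  have hle := norm_sub_le_norm_sub_of_step_inner_nonpos hy hts hsr
  have hsq := norm_sub_sq_real (y s - y t) (y r - y t)
  rw [sub_sub_sub_cancel_right, norm_sub_rev (y r)] at hsq
  nlinarith [sq_nonneg ‖y s - y t‖, norm_nonneg (y s - y r)]

/-- In a finite-dimensional space, a sequence each of whose steps makes an obtuse angle with all
later points has length at most a constant times its diameter. -/
theorem exists_sum_norm_sub_le_of_step_inner_nonpos [FiniteDimensional ℝ E] :
    ∃ C : ℝ, 0 < C ∧ ∀ (D : ℝ) (y : ℕ → E), 0 ≤ D → (∀ s t, ‖y s - y t‖ ≤ D) →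
      (∀ t s, t < s → ⟪y t - y (t + 1), y s - y (t + 1)⟫ ≤ 0) →
      ∀ n, ∑ t ∈ Finset.range n, ‖y (t + 1) - y t‖ ≤ C * D := by
  obtain ⟨W, hW⟩ := exists_finset_quarter_norm_le_inner (E := E)
  refine ⟨4 * ∑ w ∈ W, ‖w‖ + 1, by positivity, fun D y hD hdiam hy n => ?_⟩
  have hosc : ∀ w s t, ⟪w, y t⟫ - ‖w‖ * D ≤ ⟪w, y s⟫ := by
    intro w s t
    have h := (real_inner_le_norm w (y t - y s)).trans
      (mul_le_mul_of_nonneg_left (hdiam t s) (norm_nonneg w))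
    rw [inner_sub_right] at h
    linarith
  have hbdd : ∀ w t, BddBelow (Set.range fun k => ⟪w, y (t + k)⟫) := fun w t =>
    ⟨⟪w, y 0⟫ - ‖w‖ * D, by rintro _ ⟨k, rfl⟩; exact hosc w _ _⟩
  let Φ : E → ℕ → ℝ := fun w t => ⨅ k, ⟪w, y (t + k)⟫
  have hΦ_le : ∀ w t, Φ w t ≤ ⟪w, y t⟫ := fun w t => ciInf_le (hbdd w t) 0
  have hΦ_mono : ∀ w t, Φ w t ≤ Φ w (t + 1) := fun w t => le_ciInf fun k => by
    rw [add_assoc]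
    exact ciInf_le (hbdd w t) (1 + k)
  have hstep : ∀ t, 1 / 4 * ‖y (t + 1) - y t‖ ≤ ∑ w ∈ W, (Φ w (t + 1) - Φ w t) := by
    intro t
    obtain ⟨w, hw, hwU⟩ := hW {u | ∃ s, t ≤ s ∧ u = y s - y t} (by
      rintro _ ⟨s, hs, rfl⟩ _ ⟨r, hr, rfl⟩
      exact inner_sub_nonneg_of_step_inner_nonpos hy hs hr)
    refine le_trans ?_ (Finset.single_le_sum (f := fun w => Φ w (t + 1) - Φ w t)
      (fun v _ => sub_nonneg.2 (hΦ_mono v t)) hw)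
    suffices h : Φ w t + 1 / 4 * ‖y (t + 1) - y t‖ ≤ Φ w (t + 1) by
      exact le_sub_iff_add_le'.2 h
    refine le_ciInf fun k => ?_
    have h1 := hwU _ ⟨t + 1 + k, by lia, rfl⟩
    rw [inner_sub_right] at h1
    have h2 : ‖y (t + 1) - y t‖ ≤ ‖y (t + 1 + k) - y t‖ := by
      have h := norm_sub_le_norm_sub_of_inner_nonpos (a := y (t + 1 + k)) (b := y (t + 1))
        (p := y t) (by rw [real_inner_comm]; exact hy t (t + 1 + k) (by lia))
      exact h
    linarith [hΦ_le w t]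
  have htotal : ∀ w, Φ w n - Φ w 0 ≤ ‖w‖ * D := by
    intro w
    have h : ⟪w, y n⟫ - ‖w‖ * D ≤ Φ w 0 := le_ciInf fun k => hosc w _ n
    linarith [hΦ_le w n]
  have hsum : 1 / 4 * ∑ t ∈ Finset.range n, ‖y (t + 1) - y t‖ ≤ (∑ w ∈ W, ‖w‖) * D := by
    calc 1 / 4 * ∑ t ∈ Finset.range n, ‖y (t + 1) - y t‖
        ≤ ∑ t ∈ Finset.range n, ∑ w ∈ W, (Φ w (t + 1) - Φ w t) := by
          rw [Finset.mul_sum]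
          exact Finset.sum_le_sum fun t _ => hstep t
      _ = ∑ w ∈ W, (Φ w n - Φ w 0) := by
          rw [Finset.sum_comm]
          exact Finset.sum_congr rfl fun w _ => Finset.sum_range_sub _ _
      _ ≤ (∑ w ∈ W, ‖w‖) * D := by
          rw [Finset.sum_mul]
          exact Finset.sum_le_sum fun w _ => htotal w
  linarith

end SelfContracted

/-- The unperturbed nested projection curve has total movement at most `C * D`,
independently of the horizon `T`. -/
theorem nested_projection_movement_bound (d : ℕ) (hd : 1 ≤ d) :
    ∃ C : ℝ, 0 < C ∧
      ∀ (T : ℕ) (D : ℝ), 0 ≤ D →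
      ∀ (K : ℕ → Set (EuclideanSpace ℝ (Fin d)))
        (x : ℕ → EuclideanSpace ℝ (Fin d)),
        (∀ t, t ≤ T → (K t).Nonempty) →
        (∀ t, t ≤ T → IsClosed (K t)) →
        (∀ t, t ≤ T → Convex ℝ (K t)) →
        (∀ t, t < T → K (t + 1) ⊆ K t) →
        (∀ u ∈ K 0, ∀ v ∈ K 0, ‖u - v‖ ≤ D) →
        x 1 ∈ K 0 →
        (∀ t, 1 ≤ t → t ≤ T → x (t + 1) ∈ K t ∧
          ∀ y ∈ K t, ⟪x t - x (t + 1), y - x (t + 1)⟫ ≤ 0) →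
        ∑ t ∈ Finset.Icc 1 T, ‖x (t + 1) - x t‖ ≤ C * D := by
  obtain ⟨C, hC, hlen⟩ :=
    exists_sum_norm_sub_le_of_step_inner_nonpos (E := EuclideanSpace ℝ (Fin d))
  refine ⟨C, hC, fun T D hD K x _ _ _ hnest hdiam hx1 hproj => ?_⟩
  have hsub : ∀ s t, t ≤ s → s ≤ T → K s ⊆ K t := by
    intro s t hts
    induction s, hts using Nat.le_induction with
    | base => exact fun _ => subset_rfl
    | succ s _ ih => exact fun hs => (hnest s hs).trans (ih (by lia))
  have hmem : ∀ s, s ≤ T → x (s + 1) ∈ K s := by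
    intro s hs
    rcases Nat.eq_zero_or_pos s with rfl | hpos
    · exact hx1
    · exact (hproj s hpos hs).1
  have hbound := hlen D (fun s => x (min s T + 1)) hD
    (fun s t => hdiam _ (hsub _ 0 (by lia) (by lia) (hmem _ (by lia)))
      _ (hsub _ 0 (by lia) (by lia) (hmem _ (by lia))))
    (fun t s hts => by
      rcases lt_or_ge t T with ht | ht
      · rw [min_eq_left ht.le, min_eq_left (Nat.succ_le_of_lt ht)]
        exact (hproj (t + 1) (by lia) ht).2 _
          (hsub (min s T) (t + 1) (by lia) (by lia) (hmem _ (by lia)))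
      · rw [min_eq_right ht, min_eq_right (by lia : T ≤ t + 1)]
        simp) T
  refine le_of_eq_of_le ?_ hbound
  rw [← Finset.Ico_add_one_right_eq_Icc, Finset.sum_Ico_eq_sum_range, Nat.add_sub_cancel]
  refine Finset.sum_congr rfl fun t ht => ?_
  have ht := Finset.mem_range.1 ht
  rw [min_eq_left ht.le, min_eq_left (Nat.succ_le_of_lt ht), add_comm 1 t]
end

section
/- Let 𝒳 ⊆ ℝ^d be a nonempty closed convex set of diameter at most D, and let S_1 ⊇ S_2 ⊇ ⋯ be replaced by the following setup: for t = 1, …, T let S_t be nonempty closed convex subsets of 𝒳 with 𝒳 = S_0 ⊇ S_1 ⊇ ⋯ ⊇ S_T. Let η_1, …, η_T > 0 be step sizes (with the convention 1/η_0 = 0), and let H_1, …, H_T ≥ 0. For each t, let f_t : ℝ^d → ℝ and let h_t ∈ ℝ^d satisfy ‖h_t‖ ≤ G and the strong-convexity subgradient inequality: f_t(y) ≥ f_t(x_t) + ⟨h_t, y − x_t⟩ + (H_t/2)‖y − x_t‖² for all y ∈ 𝒳. Let x_1 ∈ 𝒳 and define x_{t+1} = Π_{S_t}(x_t − η_t h_t)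 for 1 ≤ t ≤ T. Then for every x* ∈ S_T: Σ_{t=1}^{T} (f_t(x_t) − f_t(x*)) ≤ (D²/2) · Σ_{t=1}^{T} max(1/η_t − 1/η_{t−1} − H_t, 0) + (G²/2) · Σ_{t=1}^{T} η_t. -/
open scoped RealInnerProductSpace

section

variable {E : Type*} [NormedAddCommGroup E] [InnerProductSpace ℝ E]

/-- A point satisfying the variational inequality of the projection of `z` is at least as close
to the test point `y` as `z` is. -/
theorem norm_sub_sq_le_of_inner_sub_nonpos {z p y : E} (hp : ⟪z - p, y - p⟫ ≤ 0) :
    ‖p - y‖ ^ 2 ≤ ‖z - y‖ ^ 2 := by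
  have hsplit : z - y = (z - p) - (y - p) := by abel
  rw [hsplit, norm_sub_sq_real (z - p), norm_sub_rev p y]
  nlinarith [sq_nonneg ‖z - p‖]

/-- The linearized regret of one projected gradient step. -/
theorem inner_le_of_projected_step {x g p y : E} {η G : ℝ} (hη : 0 < η) (hg : ‖g‖ ≤ G)
    (hp : ⟪(x - η • g) - p, y - p⟫ ≤ 0) :
    ⟪g, x - y⟫ ≤ 1 / η / 2 * ‖x - y‖ ^ 2 - 1 / η / 2 * ‖p - y‖ ^ 2 + G ^ 2 / 2 * η := by
  have hcontr := norm_sub_sq_le_of_inner_sub_nonpos hp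
  rw [sub_right_comm, norm_sub_sq_real (x - y), real_inner_smul_right, norm_smul, Real.norm_eq_abs,
    mul_pow, sq_abs, real_inner_comm] at hcontr
  have hgG : ‖g‖ ^ 2 ≤ G ^ 2 := pow_le_pow_left₀ (norm_nonneg g) hg 2
  have hscaled : η ^ 2 * ‖g‖ ^ 2 ≤ η ^ 2 * G ^ 2 := by gcongr
  refine le_of_mul_le_mul_left ?_ hη
  have hcancel : η * (1 / η / 2 * ‖x - y‖ ^ 2 - 1 / η / 2 * ‖p - y‖ ^ 2 + G ^ 2 / 2 * η) =
      ‖x - y‖ ^ 2 / 2 - ‖p - y‖ ^ 2 / 2 + η ^ 2 * G ^ 2 / 2 := by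
    field_simp
  rw [hcancel]
  linarith

end

/-- General regret bound for Nested Projected OGD (Lemma 4 of the paper).
The convention `1/η₀ = 0` is realized by `η 0 = 0` since `1/0 = 0` in Lean. -/
theorem nested_projected_ogd_regret_bound (d T : ℕ) (D G : ℝ)
    (hD : 0 ≤ D) (hG : 0 ≤ G)
    (X : Set (EuclideanSpace ℝ (Fin d)))
    (hXne : X.Nonempty) (hXcl : IsClosed X) (hXcv : Convex ℝ X)
    (hXdiam : ∀ u ∈ X, ∀ v ∈ X, ‖u - v‖ ≤ D)
    (S : ℕ → Set (EuclideanSpace ℝ (Fin d)))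
    (hS0 : S 0 = X)
    (hSne : ∀ t, t ≤ T → (S t).Nonempty)
    (hScl : ∀ t, t ≤ T → IsClosed (S t))
    (hScv : ∀ t, t ≤ T → Convex ℝ (S t))
    (hSnest : ∀ t, t < T → S (t + 1) ⊆ S t)
    (η H : ℕ → ℝ) (hη0 : η 0 = 0)
    (hη : ∀ t, 1 ≤ t → t ≤ T → 0 < η t)
    (hH : ∀ t, 1 ≤ t → t ≤ T → 0 ≤ H t)
    (f : ℕ → EuclideanSpace ℝ (Fin d) → ℝ)
    (h x : ℕ → EuclideanSpace ℝ (Fin d))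
    (hh : ∀ t, 1 ≤ t → t ≤ T → ‖h t‖ ≤ G)
    (hsub : ∀ t, 1 ≤ t → t ≤ T → ∀ y ∈ X,
      f t y ≥ f t (x t) + ⟪h t, y - x t⟫ + H t / 2 * ‖y - x t‖ ^ 2)
    (hx1 : x 1 ∈ X)
    (hproj : ∀ t, 1 ≤ t → t ≤ T → x (t + 1) ∈ S t ∧
      ∀ y ∈ S t, ⟪(x t - η t • h t) - x (t + 1), y - x (t + 1)⟫ ≤ 0)
    (xstar : EuclideanSpace ℝ (Fin d)) (hxstar : xstar ∈ S T) :
    ∑ t ∈ Finset.Icc 1 T, (f t (x t) - f t xstar) ≤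
      D ^ 2 / 2 * ∑ t ∈ Finset.Icc 1 T, max (1 / η t - 1 / η (t - 1) - H t) 0 +
      G ^ 2 / 2 * ∑ t ∈ Finset.Icc 1 T, η t := by
  have hanti : ∀ n, n ≤ T → S T ⊆ S n := fun n hn =>
    Nat.decreasingInduction' (P := fun k => S T ⊆ S k)
      (fun k hk _ ih => ih.trans (hSnest k hk)) hn subset_rfl
  have hSX : ∀ n, n ≤ T → S n ⊆ X := by
    intro n
    induction n with
    | zero => exact fun _ => hS0.subset
    | succ n ih => exact fun hn => (hSnest n hn).trans (ih (by omega))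
  have hxX : ∀ n, n ≤ T → x (n + 1) ∈ X := by
    rintro (_ | n) hn
    · exact hx1
    · exact hSX _ hn (hproj _ (by omega) hn).1
  have hstarX : xstar ∈ X := hSX T le_rfl hxstar
  have hpotential : ∀ n, n ≤ T →
      ∑ t ∈ Finset.Icc 1 n, (f t (x t) - f t xstar) + 1 / η n / 2 * ‖x (n + 1) - xstar‖ ^ 2 ≤
        D ^ 2 / 2 * ∑ t ∈ Finset.Icc 1 n, max (1 / η t - 1 / η (t - 1) - H t) 0 +
        G ^ 2 / 2 * ∑ t ∈ Finset.Icc 1 n, η t := by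
    intro n
    induction n with
    | zero => simp [hη0]
    | succ n ih =>
      intro hn
      have hpos : 1 ≤ n + 1 := by omega
      have ih := ih (by omega)
      have hstep := inner_le_of_projected_step (hη _ hpos hn) (hh _ hpos hn)
        ((hproj _ hpos hn).2 xstar (hanti _ hn hxstar))
      have hsubgrad := hsub _ hpos hn xstar hstarX
      rw [← neg_sub (x (n + 1)) xstar, inner_neg_right, norm_neg] at hsubgrad
      have hdist : ‖x (n + 1) - xstar‖ ^ 2 ≤ D ^ 2 :=
        pow_le_pow_left₀ (norm_nonneg _) (hXdiam _ (hxX n (by omega)) _ hstarX) 2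
      have hcoef : (1 / η (n + 1) - 1 / η n - H (n + 1)) * ‖x (n + 1) - xstar‖ ^ 2 ≤
          max (1 / η (n + 1) - 1 / η n - H (n + 1)) 0 * D ^ 2 :=
        mul_le_mul (le_max_left _ _) hdist (sq_nonneg _) (le_max_right _ _)
      simp only [Finset.sum_Icc_succ_top hpos, Nat.add_sub_cancel]
      linarith
  have hfinal := hpotential T le_rfl
  have hinv : 0 ≤ 1 / η T := by
    rcases Nat.eq_zero_or_pos T with hT | hT
    · simp [hT, hη0]
    · exact (one_div_pos.mpr (hη T hT le_rfl)).le
  have hlast : 0 ≤ 1 / η T / 2 * ‖x (T + 1) - xstar‖ ^ 2 := by positivity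
  linarith
end

section
/- Fix a dimension d ≥ 1. There exists a constant C > 0 depending only on d such that the following holds. Let 𝒳 ⊆ ℝ^d be a nonempty closed convex set of diameter at most D. For t = 1, …, T, let g_t : ℝ^d → ℝ be G-Lipschitz on 𝒳 with convex sublevel set {x ∈ ℝ^d : g_t(x) ≤ 0}, and define S_0 = 𝒳 and S_t = S_{t−1} ∩ {x ∈ 𝒳 : g_t(x) ≤ 0}; assume S_T ≠ ∅. Let η_1, …, η_T > 0, let h_1, …, h_T ∈ ℝ^d with ‖h_t‖ ≤ G, let x_1 ∈ 𝒳, and define x_{t+1} = Π_{S_t}(x_t − η_t h_t) for 1 ≤ t ≤ T. Then Σ_{t=1}^{T} max(g_t(x_t), 0) ≤ G · Σ_{t=1}^{T} ‖x_{t+1} − x_t‖ ≤ G · C · (D + G · Σ_{t=1}^{T} η_t). -/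
open scoped RealInnerProductSpace

section AlmostSelfContracted

variable {E : Type*} [NormedAddCommGroup E] [InnerProductSpace ℝ E]

/-- A finite-dimensional space has a finite set of directions which contains a uniformly
separating direction for every set of almost pairwise non-obtuse unit vectors. -/
theorem exists_finset_separating_unit [FiniteDimensional ℝ E] :
    ∃ (N : Finset E) (c ε : ℝ), 0 < c ∧ 0 < ε ∧ ε ≤ 1 ∧ (∀ u ∈ N, ‖u‖ ≤ 1) ∧
      ∀ V : Set E, (∀ a ∈ V, ‖a‖ = 1) → (∀ a ∈ V, ∀ b ∈ V, -ε ≤ ⟪a, b⟫) →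
        ∃ u ∈ N, ∀ a ∈ V, ⟪a, u⟫ ≤ -c := by
  have hK : IsCompact (Metric.closedBall (0 : E) 1) := isCompact_closedBall 0 1
  have net : ∀ r : ℝ, 0 < r → ∃ N : Finset E, (∀ u ∈ N, ‖u‖ ≤ 1) ∧
      ∀ v : E, ‖v‖ ≤ 1 → ∃ u ∈ N, ‖v - u‖ < r := by
    intro r hr
    obtain ⟨t, ht, hfin, hcov⟩ := hK.finite_cover_balls hr
    refine ⟨hfin.toFinset, fun u hu => ?_, fun v hv => ?_⟩
    · simpa using ht (hfin.mem_toFinset.1 hu)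
    · have := hcov (show v ∈ Metric.closedBall (0 : E) 1 by simpa using hv)
      simp only [Set.mem_iUnion, Metric.mem_ball, exists_prop] at this
      obtain ⟨u, hu, h⟩ := this
      exact ⟨u, hfin.mem_toFinset.2 hu, by rwa [← dist_eq_norm]⟩
  obtain ⟨F, -, hFc⟩ := net (1 / 4) (by norm_num)
  set M : ℝ := F.card + 1 with hM
  have hM1 : 1 ≤ M := by simp [hM]
  have hM0 : 0 < M := by linarith
  obtain ⟨N, hN1, hNc⟩ := net (1 / (4 * M)) (by positivity)
  have hε1 : 1 / (4 * M) ≤ 1 := by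
    rw [div_le_one (by positivity)]; linarith
  refine ⟨N, 1 / (4 * M), 1 / (4 * M), by positivity, by positivity, hε1, hN1, ?_⟩
  intro V hV1 hV
  have hrep : ∀ f : E, ∃ v : E, ‖v‖ ≤ 1 ∧ (∀ y ∈ V, -(1 / (4 * M)) ≤ ⟪y, v⟫) ∧
      ∀ y ∈ V, ‖y - f‖ < 1 / 4 → 3 / 4 ≤ ⟪y, v⟫ := by
    intro f
    by_cases hf : ∃ v ∈ V, ‖v - f‖ < 1 / 4
    · obtain ⟨v, hv, hvf⟩ := hf
      refine ⟨v, (hV1 v hv).le, fun y hy => hV y hy v hv, fun y hy hyf => ?_⟩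
      have h1 : ‖y - v‖ ≤ 1 / 2 := by
        have := norm_sub_le (y - f) (v - f)
        rw [sub_sub_sub_cancel_right] at this
        linarith
      have h2 := norm_sub_sq_real y v
      rw [hV1 y hy, hV1 v hv] at h2
      nlinarith [norm_nonneg (y - v)]
    · refine ⟨0, by simp, fun y _ => ?_, fun y hy hyf => (hf ⟨y, hy, hyf⟩).elim⟩
      have : 0 < 1 / (4 * M) := by positivity
      simp only [inner_zero_right]
      linarith
  choose φ hφ1 hφ2 hφ3 using hrep
  set w : E := ∑ f ∈ F, φ f with hw
  have hwn : ‖w‖ ≤ M := by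
    calc ‖w‖ ≤ ∑ f ∈ F, ‖φ f‖ := norm_sum_le _ _
      _ ≤ ∑ f ∈ F, (1 : ℝ) := Finset.sum_le_sum fun f _ => hφ1 f
      _ ≤ M := by simp [hM]
  have hwi : ∀ y ∈ V, 1 / 2 ≤ ⟪y, w⟫ := by
    classical
    intro y hy
    obtain ⟨f₀, hf₀, hyf⟩ := hFc y (hV1 y hy).le
    have h1 : ∑ f ∈ F, (-(1 / (4 * M)) + if f = f₀ then (3 / 4 : ℝ) else 0) ≤ ⟪y, w⟫ := by
      rw [hw, inner_sum]
      refine Finset.sum_le_sum fun f _ => ?_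
      split_ifs with hff
      · have := hφ3 f y hy (hff ▸ hyf)
        have : 0 < 1 / (4 * M) := by positivity
        linarith
      · simpa using hφ2 f y hy
    rw [Finset.sum_add_distrib, Finset.sum_ite_eq' F f₀, if_pos hf₀, Finset.sum_const,
      nsmul_eq_mul] at h1
    have h2 : (F.card : ℝ) * (1 / (4 * M)) ≤ 1 / 4 := by
      rw [mul_one_div, div_le_div_iff₀ (by positivity) (by norm_num)]
      linarith
    linarith
  have hu : ‖-(M⁻¹ • w)‖ ≤ 1 := by
    rw [norm_neg, norm_smul, Real.norm_of_nonneg (by positivity), inv_mul_le_iff₀ hM0]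
    linarith
  obtain ⟨n, hn, hun⟩ := hNc _ hu
  refine ⟨n, hn, fun y hy => ?_⟩
  have h1 : ⟪y, n⟫ = -(M⁻¹ * ⟪y, w⟫) - ⟪y, -(M⁻¹ • w) - n⟫ := by
    rw [inner_sub_right, inner_neg_right, inner_smul_right]; ring
  have h2 := abs_le.1 (abs_real_inner_le_norm y (-(M⁻¹ • w) - n))
  rw [hV1 y hy, one_mul] at h2
  have h3 : M⁻¹ * (1 / 2) ≤ M⁻¹ * ⟪y, w⟫ :=
    mul_le_mul_of_nonneg_left (hwi y hy) (by positivity)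
  have h4 : M⁻¹ * (1 / 2) = 1 / (4 * M) + 1 / (4 * M) := by field_simp; norm_num
  linarith [h2.1]

/-- Version of `exists_finset_separating_unit` for vectors of arbitrary length. -/
theorem exists_finset_separating [FiniteDimensional ℝ E] :
    ∃ (N : Finset E) (c ε : ℝ), 0 < c ∧ 0 < ε ∧ ε ≤ 1 ∧ (∀ u ∈ N, ‖u‖ ≤ 1) ∧
      ∀ V : Set E, (∀ a ∈ V, ∀ b ∈ V, -(ε * (‖a‖ * ‖b‖)) ≤ ⟪a, b⟫) →
        ∃ u ∈ N, ∀ a ∈ V, ⟪a, u⟫ ≤ -(c * ‖a‖) := by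
  obtain ⟨N, c, ε, hc, hε, hε1, hN, h⟩ := exists_finset_separating_unit (E := E)
  refine ⟨N, c, ε, hc, hε, hε1, hN, fun V hV => ?_⟩
  have hsep : ∃ u ∈ N, ∀ v ∈ {v | ∃ a ∈ V, a ≠ 0 ∧ v = ‖a‖⁻¹ • a}, ⟪v, u⟫ ≤ -c := by
    refine h _ ?_ ?_
    · rintro _ ⟨a, -, ha0, rfl⟩
      rw [norm_smul, norm_inv, norm_norm, inv_mul_cancel₀ (norm_ne_zero_iff.2 ha0)]
    · rintro _ ⟨a, ha, ha0, rfl⟩ _ ⟨b, hb, hb0, rfl⟩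
      have hpa : 0 < ‖a‖ := norm_pos_iff.2 ha0
      have hpb : 0 < ‖b‖ := norm_pos_iff.2 hb0
      rw [real_inner_smul_left, real_inner_smul_right, ← mul_assoc, ← mul_inv,
        ← div_eq_inv_mul, le_div_iff₀ (by positivity)]
      linarith [hV a ha b hb]
  obtain ⟨u, hu, hsep⟩ := hsep
  refine ⟨u, hu, fun a ha => ?_⟩
  by_cases ha0 : a = 0
  · simp [ha0]
  have hpos : 0 < ‖a‖ := norm_pos_iff.2 ha0
  have := hsep _ ⟨a, ha, ha0, rfl⟩
  rw [real_inner_smul_left, inv_mul_le_iff₀ hpos] at this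
  linarith

/-- A finite sequence which is self-contracted up to errors `e k` has length controlled by its
diameter and the total error. -/
theorem exists_length_bound_of_almost_selfContracted [FiniteDimensional ℝ E] :
    ∃ C : ℝ, 0 < C ∧ ∀ (T : ℕ) (D : ℝ) (p : ℕ → E) (e : ℕ → ℝ), 0 ≤ D →
      (∀ k < T, 0 ≤ e k) →
      (∀ k j, k < j → j ≤ T → ‖p (k + 1) - p j‖ ≤ ‖p k - p j‖ + e k) →
      (∀ i ≤ T, ∀ j ≤ T, ‖p i - p j‖ ≤ D) →
      ∑ k ∈ Finset.range T, ‖p (k + 1) - p k‖ ≤ C * (D + ∑ k ∈ Finset.range T, e k) := by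
  obtain ⟨N, c, ε, hc, hε, hε1, hN, hsep⟩ := exists_finset_separating (E := E)
  set L : ℝ := 2 / ε with hL
  have hL0 : 0 < L := by positivity
  have hLε : ε * L = 2 := by rw [hL]; field_simp
  set c' : ℝ := min c 1 with hc'
  have hc'0 : 0 < c' := lt_min hc one_pos
  refine ⟨1 + 2 * (N.card * (1 + 2 * L)) / c', by positivity, ?_⟩
  intro T D p e hD he hcon hdiam
  set s : ℕ → ℝ := fun k => ∑ i ∈ Finset.range k, e i with hs
  have hs_succ : ∀ k, s (k + 1) = s k + e k := fun k => Finset.sum_range_succ _ _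
  have hs_mono : ∀ i j, i ≤ j → j ≤ T → s i ≤ s j := by
    intro i j hij hj
    induction j, hij using Nat.le_induction with
    | base => exact le_rfl
    | succ j hij ih => linarith [ih (by omega), he j (by omega), hs_succ j]
  have hs0 : s 0 = 0 := by simp [hs]
  have hclose : ∀ t a b, t ≤ a → a ≤ b → b ≤ T →
      ‖p a - p b‖ ≤ ‖p t - p b‖ + (s a - s t) := by
    intro t a b hta hab hb
    induction a, hta using Nat.le_induction with
    | base => simp
    | succ a hta ih => linarith [ih (by omega), hcon a b (by omega) hb, hs_succ a]
  have hdir : ∀ t < T, ∃ u ∈ N, ∀ j, t < j → j ≤ T →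
      ⟪p j - p t, u⟫ - 2 * L * (s j - s t) ≤ -(c' * ‖p j - p t‖) := by
    intro t ht
    have hsepu : ∃ u ∈ N, ∀ a ∈ {a | ∃ j, t < j ∧ j ≤ T ∧ L * (s j - s t) < ‖p j - p t‖ ∧
        a = p j - p t}, ⟪a, u⟫ ≤ -(c * ‖a‖) := by
      apply hsep
      have key : ∀ i j, t < i → i ≤ j → j ≤ T → L * (s i - s t) < ‖p i - p t‖ →
          -(ε * (‖p i - p t‖ * ‖p j - p t‖)) ≤ ⟪p i - p t, p j - p t⟫ := by
        intro i j hti hij hj hbig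
        have h1 := hclose t i j hti.le hij hj
        have h0 := hs_mono t i hti.le (hij.trans hj)
        have h2 := norm_sub_sq_real (p i - p t) (p j - p t)
        rw [sub_sub_sub_cancel_right] at h2
        rw [norm_sub_rev (p t)] at h1
        set A := ‖p i - p t‖
        set B := ‖p j - p t‖
        set Δ := s i - s t
        have hA : 0 ≤ A := norm_nonneg _
        have hB : 0 ≤ B := norm_nonneg _
        have hΔ : 0 ≤ Δ := sub_nonneg.2 h0
        have h3 : 2 * Δ ≤ ε * A := by nlinarith
        have h4 : ‖p i - p j‖ ^ 2 ≤ (B + Δ) ^ 2 := pow_le_pow_left₀ (norm_nonneg _) h1 2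
        have h5 : Δ ≤ A := by nlinarith
        have h6 : Δ ^ 2 ≤ A ^ 2 := pow_le_pow_left₀ hΔ h5 2
        have h7 : 2 * Δ * B ≤ ε * A * B := mul_le_mul_of_nonneg_right h3 hB
        have h8 : 0 ≤ ε * A * B := by positivity
        linarith
      rintro _ ⟨i, hti, hi, hbi, rfl⟩ _ ⟨j, htj, hj, hbj, rfl⟩
      rcases le_total i j with hij | hij
      · exact key i j hti hij hj hbi
      · rw [real_inner_comm, mul_comm ‖p i - p t‖]
        exact key j i htj hij hi hbj
    obtain ⟨u, hu, hsepu⟩ := hsepu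
    refine ⟨u, hu, fun j htj hj => ?_⟩
    have hst := hs_mono t j htj.le hj
    by_cases hbig : L * (s j - s t) < ‖p j - p t‖
    · have h1 := hsepu _ ⟨j, htj, hj, hbig, rfl⟩
      have h2 : c' * ‖p j - p t‖ ≤ c * ‖p j - p t‖ :=
        mul_le_mul_of_nonneg_right (min_le_left _ _) (norm_nonneg _)
      nlinarith [mul_nonneg hL0.le (sub_nonneg.2 hst)]
    · have h1 := real_inner_le_norm (p j - p t) u
      have h2 : ‖p j - p t‖ * ‖u‖ ≤ ‖p j - p t‖ :=
        mul_le_of_le_one_right (norm_nonneg _) (hN u hu)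
      have h3 : c' * ‖p j - p t‖ ≤ ‖p j - p t‖ :=
        mul_le_of_le_one_left (norm_nonneg _) (min_le_right _ _)
      linarith
  -- The potential is the support function of the tail, enlarged by the remaining error.
  let H : ℕ → E → ℝ := fun t u =>
    if ht : t ≤ T then
      (Finset.Icc t T).sup' (Finset.nonempty_Icc.2 ht) (fun j => ⟪p j, u⟫ - 2 * L * s j)
    else 0
  have hH_le : ∀ t ≤ T, ∀ u B, (∀ j, t ≤ j → j ≤ T → ⟪p j, u⟫ - 2 * L * s j ≤ B) →
      H t u ≤ B := by
    intro t ht u B hB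
    simp only [H, dif_pos ht]
    refine Finset.sup'_le _ _ fun j hj => ?_
    rw [Finset.mem_Icc] at hj
    exact hB j hj.1 hj.2
  have hle_H : ∀ t u j, t ≤ j → j ≤ T → ⟪p j, u⟫ - 2 * L * s j ≤ H t u := by
    intro t u j htj hj
    simp only [H, dif_pos (htj.trans hj)]
    exact Finset.le_sup' (fun j => ⟪p j, u⟫ - 2 * L * s j) (Finset.mem_Icc.2 ⟨htj, hj⟩)
  have hH_anti : ∀ t < T, ∀ u, 0 ≤ H t u - H (t + 1) u := fun t ht u =>
    sub_nonneg.2 (hH_le _ ht u _ fun j hj hjT => hle_H t u j (by omega) hjT)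
  have hstep : ∀ t < T, c' * ((‖p (t + 1) - p t‖ - e t) / 2) ≤
      (∑ u ∈ N, H t u) - ∑ u ∈ N, H (t + 1) u := by
    intro t ht
    obtain ⟨u, hu, hud⟩ := hdir t ht
    rw [← Finset.sum_sub_distrib]
    refine le_trans ?_ (Finset.single_le_sum (f := fun u => H t u - H (t + 1) u)
      (fun u _ => hH_anti t ht u) hu)
    have h1 := hle_H t u t le_rfl ht.le
    have h2 : H (t + 1) u ≤
        ⟪p t, u⟫ - 2 * L * s t - c' * ((‖p (t + 1) - p t‖ - e t) / 2) := by
      refine hH_le _ ht u _ fun j hj hjT => ?_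
      have h3 := hud j hj hjT
      rw [inner_sub_left] at h3
      have h4 : (‖p (t + 1) - p t‖ - e t) / 2 ≤ ‖p j - p t‖ := by
        have h5 := hcon t j hj hjT
        have h6 := norm_sub_le (p (t + 1) - p j) (p t - p j)
        rw [sub_sub_sub_cancel_right] at h6
        rw [norm_sub_rev (p j)]
        linarith
      have h7 := mul_le_mul_of_nonneg_left h4 hc'0.le
      linarith
    show _ ≤ H t u - H (t + 1) u
    linarith
  have htotal : (∑ u ∈ N, H 0 u) - ∑ u ∈ N, H T u ≤ N.card * (D + 2 * L * s T) := by
    rw [← Finset.sum_sub_distrib, ← nsmul_eq_mul]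
    refine Finset.sum_le_card_nsmul _ _ _ fun u hu => ?_
    have h1 := hle_H T u T le_rfl le_rfl
    have h2 : H 0 u ≤ ⟪p T, u⟫ + D := by
      refine hH_le 0 (Nat.zero_le _) u _ fun j _ hj => ?_
      have h3 := real_inner_le_norm (p j - p T) u
      rw [inner_sub_left] at h3
      have h4 : ‖p j - p T‖ * ‖u‖ ≤ ‖p j - p T‖ :=
        mul_le_of_le_one_right (norm_nonneg _) (hN u hu)
      have h5 := hs_mono 0 j (Nat.zero_le _) hj
      rw [hs0] at h5
      have h6 : 0 ≤ 2 * L * s j := by positivity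
      linarith [hdiam j hj T le_rfl]
    linarith
  have hsum := Finset.sum_le_sum fun t (ht : t ∈ Finset.range T) =>
    hstep t (Finset.mem_range.1 ht)
  rw [Finset.sum_range_sub', ← Finset.mul_sum, ← Finset.sum_div,
    Finset.sum_sub_distrib] at hsum
  change _ ≤ _ * (D + s T)
  change c' * ((_ - s T) / 2) ≤ _ at hsum
  have hsT : 0 ≤ s T := hs0 ▸ hs_mono 0 T (Nat.zero_le _) le_rfl
  have hmain : (∑ k ∈ Finset.range T, ‖p (k + 1) - p k‖) - s T ≤
      2 * (N.card * (1 + 2 * L)) / c' * (D + s T) := by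
    rw [div_mul_eq_mul_div, le_div_iff₀ hc'0]
    have h1 : (N.card : ℝ) * (D + 2 * L * s T) ≤ N.card * ((1 + 2 * L) * (D + s T)) := by
      refine mul_le_mul_of_nonneg_left ?_ (Nat.cast_nonneg _)
      nlinarith [mul_nonneg hL0.le hD]
    linarith
  linarith

end AlmostSelfContracted

/-- Moving from a point to its projection on a convex set does not increase the distance to the
points of that set. -/
theorem norm_sub_le_norm_sub_of_inner_nonpos_s10 {E : Type*} [NormedAddCommGroup E]
    [InnerProductSpace ℝ E] {z q y : E} (hq : ⟪z - q, y - q⟫ ≤ 0) : ‖q - y‖ ≤ ‖z - y‖ := by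
  have h1 := norm_sub_sq_real (z - q) (y - q)
  rw [sub_sub_sub_cancel_right] at h1
  rw [norm_sub_rev q]
  refine (sq_le_sq₀ (norm_nonneg _) (norm_nonneg _)).1 ?_
  nlinarith [sq_nonneg ‖z - q‖]

/-- CCV bound for Nested Projected OGD (Lemma 5 of the paper): the cumulative
constraint violation is at most `G` times the movement, which is at most
`G * C * (D + G * Σ η_t)` with `C` depending only on the dimension. -/
theorem nested_projected_ogd_ccv_bound (d : ℕ) (hd : 1 ≤ d) :
    ∃ C : ℝ, 0 < C ∧
      ∀ (T : ℕ) (D G : ℝ), 0 ≤ D → 0 ≤ G →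
      ∀ (X : Set (EuclideanSpace ℝ (Fin d))),
        X.Nonempty → IsClosed X → Convex ℝ X →
        (∀ u ∈ X, ∀ v ∈ X, ‖u - v‖ ≤ D) →
      ∀ (g : ℕ → EuclideanSpace ℝ (Fin d) → ℝ),
        (∀ t, 1 ≤ t → t ≤ T → ∀ u ∈ X, ∀ v ∈ X, |g t u - g t v| ≤ G * ‖u - v‖) →
        (∀ t, 1 ≤ t → t ≤ T → Convex ℝ {y : EuclideanSpace ℝ (Fin d) | g t y ≤ 0}) →
      ∀ (S : ℕ → Set (EuclideanSpace ℝ (Fin d))),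
        S 0 = X →
        (∀ t, 1 ≤ t → t ≤ T → S t = S (t - 1) ∩ {y ∈ X | g t y ≤ 0}) →
        (S T).Nonempty →
      ∀ (η : ℕ → ℝ), (∀ t, 1 ≤ t → t ≤ T → 0 < η t) →
      ∀ (h x : ℕ → EuclideanSpace ℝ (Fin d)),
        (∀ t, 1 ≤ t → t ≤ T → ‖h t‖ ≤ G) →
        x 1 ∈ X →
        (∀ t, 1 ≤ t → t ≤ T → x (t + 1) ∈ S t ∧
          ∀ y ∈ S t, ⟪(x t - η t • h t) - x (t + 1), y - x (t + 1)⟫ ≤ 0) →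
        ∑ t ∈ Finset.Icc 1 T, max (g t (x t)) 0 ≤
            G * ∑ t ∈ Finset.Icc 1 T, ‖x (t + 1) - x t‖ ∧
          G * ∑ t ∈ Finset.Icc 1 T, ‖x (t + 1) - x t‖ ≤
            G * C * (D + G * ∑ t ∈ Finset.Icc 1 T, η t) := by
  obtain ⟨C, hC, hbound⟩ :=
    exists_length_bound_of_almost_selfContracted (E := EuclideanSpace ℝ (Fin d))
  refine ⟨C, hC, ?_⟩
  intro T D G hD hG X _ _ _ hdiam g hg _ S hS0 hS _ η hη h x hh hx1 hx
  have hanti : ∀ i j, i ≤ j → j ≤ T → S j ⊆ S i := by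
    intro i j hij hj
    induction j, hij using Nat.le_induction with
    | base => exact subset_rfl
    | succ j hij ih =>
      rw [hS (j + 1) (by omega) hj]
      exact Set.inter_subset_left.trans (ih (by omega))
  have hxS : ∀ j ≤ T, x (j + 1) ∈ S j := by
    intro j hj
    rcases Nat.eq_zero_or_pos j with rfl | hpos
    · rwa [hS0]
    · exact (hx j hpos hj).1
  have hxX : ∀ j ≤ T, x (j + 1) ∈ X := fun j hj =>
    hS0 ▸ hanti 0 j (Nat.zero_le _) hj (hxS j hj)
  refine ⟨?_, ?_⟩
  · rw [Finset.mul_sum]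
    refine Finset.sum_le_sum fun t ht => ?_
    obtain ⟨ht1, htT⟩ := Finset.mem_Icc.1 ht
    have h1 : x t ∈ X := by
      have := hxX (t - 1) (by omega)
      rwa [Nat.sub_add_cancel ht1] at this
    have h2 := hxS t htT
    rw [hS t ht1 htT] at h2
    have h3 : g t (x (t + 1)) ≤ 0 := h2.2.2
    have h4 := (abs_le.1 (hg t ht1 htT _ h2.2.1 _ h1)).1
    exact max_le (by linarith) (mul_nonneg hG (norm_nonneg _))
  · rw [mul_assoc]
    refine mul_le_mul_of_nonneg_left ?_ hG
    have hIcc : ∀ f : ℕ → ℝ, ∑ t ∈ Finset.Icc 1 T, f t = ∑ k ∈ Finset.range T, f (k + 1) := by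
      intro f
      rw [Finset.range_eq_Ico, Finset.sum_Ico_add' f 0 T 1]
      rfl
    rw [hIcc, hIcc, Finset.mul_sum]
    refine hbound T D (fun k => x (k + 1)) (fun k => G * η (k + 1)) hD
      (fun k hk => mul_nonneg hG (hη (k + 1) (by omega) hk).le) ?_
      (fun i hi j hj => hdiam _ (hxX i hi) _ (hxX j hj))
    intro k j hkj hj
    have hk1 : 1 ≤ k + 1 := by omega
    have hkT : k + 1 ≤ T := by omega
    have hproj := (hx (k + 1) hk1 hkT).2 _ (hanti (k + 1) j hkj hj (hxS j hj))
    show ‖x (k + 1 + 1) - x (j + 1)‖ ≤ ‖x (k + 1) - x (j + 1)‖ + G * η (k + 1)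
    have h1 := norm_sub_le_norm_sub_of_inner_nonpos_s10 hproj
    have h2 := norm_sub_le (x (k + 1) - x (j + 1)) (η (k + 1) • h (k + 1))
    rw [sub_right_comm, norm_smul, Real.norm_of_nonneg (hη _ hk1 hkT).le] at h2
    have h3 := mul_le_mul_of_nonneg_left (hh _ hk1 hkT) (hη _ hk1 hkT).le
    linarith
end

section
/- Fix a dimension d ≥ 1. There exists a constant C > 0 depending only on d such that the following holds. Let 𝒳 ⊆ ℝ^d be a nonempty closed convex set of diameter at most D > 0, and let G > 0. For t = 1, …, T, let g_t : ℝ^d → ℝ be G-Lipschitz on 𝒳 with convex sublevel set {x : g_t(x) ≤ 0}, define S_0 = 𝒳 and S_t = S_{t−1} ∩ {x ∈ 𝒳 : g_t(x) ≤ 0}, and assume S_T ≠ ∅. Let h_1, …, h_T ∈ ℝ^d with ‖h_t‖ ≤ G, and run Nested Projected OGD with step sizes η_t = D/(G√t): x_1 ∈ 𝒳 and x_{t+1} = Π_{S_t}(x_t − η_t h_t). Then the cumulative constraint violation satisfies Σ_{t=1}^{T} max(g_t(x_t), 0) ≤ C · G · (D + 2D√T). -/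
open scoped RealInnerProductSpace

/-- A potential argument: if at every time some coordinate of `a` drops by at least `r i` below all
its later values, and no coordinate exceeds its final value by more than `M`, then `∑ r i` is at most
the number of coordinates times `M`. -/
lemma sum_le_card_mul_of_forall_exists_drop {ι : Type*} [Fintype ι] {M : ℝ} {N : ℕ}
    {a : ℕ → ι → ℝ} {r : ℕ → ℝ}
    (hdrop : ∀ i < N, ∃ θ, ∀ j, i < j → j ≤ N → a j θ + r i ≤ a i θ)
    (hM : ∀ i ≤ N, ∀ θ, a i θ - a N θ ≤ M) :
    ∑ i ∈ Finset.range N, r i ≤ Fintype.card ι * M := by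
  classical
  obtain ⟨F, hF, hsum⟩ : ∃ F : ι → ℝ, (∀ θ, ∃ s ≤ N, F θ = a s θ) ∧
      ∑ i ∈ Finset.range N, r i ≤ ∑ θ, (F θ - a N θ) := by
    clear hM
    induction N generalizing a r with
    | zero => exact ⟨a 0, fun θ => ⟨0, le_rfl, rfl⟩, by simp⟩
    | succ N ih =>
      obtain ⟨F, hF, hsum⟩ := ih (a := fun i => a (i + 1)) (r := fun i => r (i + 1)) (by
        intro i hi
        obtain ⟨θ, hθ⟩ := hdrop (i + 1) (by omega)
        exact ⟨θ, fun j hij hj => hθ (j + 1) (by omega) (by omega)⟩)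
      refine ⟨fun θ => max (F θ) (a 0 θ), fun θ => ?_, ?_⟩
      · rcases max_choice (F θ) (a 0 θ) with h | h
        · obtain ⟨s, hs, hs'⟩ := hF θ
          exact ⟨s + 1, by omega, h.trans hs'⟩
        · exact ⟨0, by omega, h⟩
      · obtain ⟨θ₀, hθ₀⟩ := hdrop 0 (by omega)
        obtain ⟨s, hs, hs'⟩ := hF θ₀
        have h0 : F θ₀ + r 0 ≤ a 0 θ₀ := hs' ▸ hθ₀ (s + 1) (by omega) (by omega)
        have h1 : r 0 ≤ ∑ θ, (max (F θ) (a 0 θ) - F θ) := by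
          refine le_trans ?_ (Finset.single_le_sum (f := fun θ => max (F θ) (a 0 θ) - F θ)
            (fun θ _ => sub_nonneg.2 (le_max_left _ _)) (Finset.mem_univ θ₀))
          have := le_max_right (F θ₀) (a 0 θ₀)
          linarith
        rw [Finset.sum_range_succ']
        simp only [Finset.sum_sub_distrib] at *
        linarith
  refine hsum.trans ?_
  have : ∑ θ, (F θ - a N θ) ≤ ∑ _θ : ι, M := Finset.sum_le_sum fun θ _ => by
    obtain ⟨s, hs, hs'⟩ := hF θ
    rw [hs']
    exact hM s hs θ
  simpa using this

section

variable {E : Type*} [NormedAddCommGroup E] [InnerProductSpace ℝ E] [FiniteDimensional ℝ E]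

/-- Closed balls of a finite-dimensional space have finite nets. -/
lemma exists_finset_forall_closedBall_dist_lt (R : ℝ) {δ : ℝ} (hδ : 0 < δ) :
    ∃ P : Finset E, ∀ v : E, ‖v‖ ≤ R → ∃ p ∈ P, dist v p < δ := by
  have : ProperSpace E := FiniteDimensional.proper ℝ E
  obtain ⟨t, ht, hcov⟩ := Metric.totallyBounded_iff.1
    (isCompact_closedBall (0 : E) R).totallyBounded δ hδ
  refine ⟨ht.toFinset, fun v hv => ?_⟩
  have := hcov (mem_closedBall_zero_iff.2 hv)
  simpa using this

/-- Finitely many directions suffice to find, for every set of pairwise almost non-obtuse unit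
vectors, one that makes an acute angle, bounded away from `π / 2`, with all of them. -/
lemma exists_finset_common_direction_of_unit :
    ∃ (Θ : Finset E) (B : ℝ), 1 ≤ B ∧ ∀ V : Set E, (∀ v ∈ V, ‖v‖ = 1) →
      (∀ v ∈ V, ∀ w ∈ V, -1 ≤ B * ⟪v, w⟫) → ∃ θ ∈ Θ, ∀ v ∈ V, 1 / 8 ≤ ⟪θ, v⟫ := by
  classical
  obtain ⟨P, hP⟩ := exists_finset_forall_closedBall_dist_lt (E := E) 1 (δ := 1 / 2) (by norm_num)
  obtain ⟨Q, hQ⟩ := exists_finset_forall_closedBall_dist_lt (E := E) P.card (δ := 1 / 8)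
    (by norm_num)
  have hn : (0 : ℝ) ≤ P.card := Nat.cast_nonneg _
  refine ⟨Q, 4 * (P.card + 1), by linarith, fun V hV hVV => ?_⟩
  have hu : ∀ p : E, ∃ u : E, ‖u‖ ≤ 1 ∧ (u = 0 ∨ u ∈ V) ∧
      ∀ v ∈ V, dist v p < 1 / 2 → u ∈ V ∧ dist u p < 1 / 2 := by
    intro p
    by_cases h : ∃ u ∈ V, dist u p < 1 / 2
    · obtain ⟨u, huV, hup⟩ := h
      exact ⟨u, (hV u huV).le, Or.inr huV, fun _ _ _ => ⟨huV, hup⟩⟩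
    · exact ⟨0, by simp, Or.inl rfl, fun v hv hvp => absurd ⟨v, hv, hvp⟩ h⟩
  choose u hu1 hu0 hup using hu
  have hξ : ‖∑ p ∈ P, u p‖ ≤ P.card := by
    simpa using norm_sum_le_of_le P (fun p _ => hu1 p)
  obtain ⟨θ, hθ, hdist⟩ := hQ _ hξ
  refine ⟨θ, hθ, fun v hv => ?_⟩
  obtain ⟨p, hp, hvp⟩ := hP v (hV v hv).le
  obtain ⟨hupV, hupd⟩ := hup p v hv hvp
  have hsame : 1 / 2 ≤ ⟪u p, v⟫ := by
    have h1 : ‖u p - v‖ < 1 := by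
      rw [← dist_eq_norm]
      have := dist_triangle_right (u p) v p
      linarith
    have h2 := norm_sub_sq_real (u p) v
    rw [hV v hv, hV _ hupV] at h2
    nlinarith [norm_nonneg (u p - v)]
  have hother : ∀ q ∈ P, -(1 / (4 * (P.card + 1 : ℝ))) ≤ ⟪u q, v⟫ := by
    intro q _
    rcases hu0 q with h | h
    · rw [h, inner_zero_left]
      exact neg_nonpos.2 (by positivity)
    · rw [← neg_div, div_le_iff₀ (by positivity)]
      linarith [hVV _ h v hv]
  have hsum : 1 / 4 ≤ ⟪∑ p ∈ P, u p, v⟫ := by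
    rw [sum_inner, ← Finset.add_sum_erase _ _ hp]
    have h1 : -(1 / 4 : ℝ) ≤ ∑ q ∈ P.erase p, ⟪u q, v⟫ := by
      have h2 := Finset.card_nsmul_le_sum (P.erase p) (fun q => ⟪u q, v⟫) _
        (fun q hq => hother q (Finset.mem_of_mem_erase hq))
      refine le_trans ?_ h2
      have h3 : ((P.erase p).card : ℝ) ≤ P.card := by
        exact_mod_cast Finset.card_le_card (Finset.erase_subset _ _)
      rw [nsmul_eq_mul, mul_neg, neg_le_neg_iff, mul_one_div, div_le_iff₀ (by positivity)]
      linarith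
    linarith
  have herr : ⟪∑ p ∈ P, u p, v⟫ - ⟪θ, v⟫ ≤ 1 / 8 := by
    rw [← inner_sub_left]
    refine (real_inner_le_norm _ _).trans ?_
    rw [hV v hv, mul_one, ← dist_eq_norm]
    exact hdist.le
  linarith

/-- The version of `exists_finset_common_direction_of_unit` without normalization. -/
lemma exists_finset_common_direction :
    ∃ (Θ : Finset E) (B : ℝ), 1 ≤ B ∧ ∀ V : Set E,
      (∀ v ∈ V, ∀ w ∈ V, -(‖v‖ * ‖w‖) ≤ B * ⟪v, w⟫) →
        ∃ θ ∈ Θ, ∀ v ∈ V, ‖v‖ / 8 ≤ ⟪θ, v⟫ := by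
  obtain ⟨Θ, B, hB, h⟩ := exists_finset_common_direction_of_unit (E := E)
  refine ⟨Θ, B, hB, fun V hV => ?_⟩
  obtain ⟨θ, hθ, hθV⟩ := h {u | ∃ v ∈ V, v ≠ 0 ∧ u = ‖v‖⁻¹ • v} (by
      rintro _ ⟨v, _, hv, rfl⟩
      exact norm_smul_inv_norm (𝕜 := ℝ) hv) (by
      rintro _ ⟨v, hvV, hv, rfl⟩ _ ⟨w, hwV, hw, rfl⟩
      have hv' := norm_pos_iff.2 hv
      have hw' := norm_pos_iff.2 hw
      have := hV v hvV w hwV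
      rw [real_inner_smul_left, real_inner_smul_right]
      calc (-1 : ℝ) = ‖v‖⁻¹ * ‖w‖⁻¹ * -(‖v‖ * ‖w‖) := by field_simp
        _ ≤ ‖v‖⁻¹ * ‖w‖⁻¹ * (B * ⟪v, w⟫) := by gcongr
        _ = _ := by ring)
  refine ⟨θ, hθ, fun v hv => ?_⟩
  rcases eq_or_ne v 0 with rfl | hv0
  · simp
  have hv' := norm_pos_iff.2 hv0
  have := hθV _ ⟨v, hv, hv0, rfl⟩
  rw [real_inner_smul_right, inv_mul_eq_div, le_div_iff₀ hv'] at this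
  linarith

/-- A length bound for perturbed self-contracted sequences. Here `e` is the accumulated
perturbation, so for constant `e` the sequence `x` is self-contracted. -/
theorem exists_sum_le_of_perturbed_selfContracted :
    ∃ C : ℝ, 0 < C ∧ ∀ (N : ℕ) (D : ℝ) (x : ℕ → E) (e r : ℕ → ℝ), Monotone e →
      (∀ i ≤ N, ‖x i - x N‖ ≤ D) →
      (∀ i j k, i < j → j ≤ k → k ≤ N → ‖x j - x k‖ ≤ ‖x i - x k‖ + (e j - e i)) →
      (∀ i j, i < j → j ≤ N → r i ≤ ‖x i - x j‖) →
      ∑ i ∈ Finset.range N, r i ≤ C * (D + (e N - e 0)) := by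
  obtain ⟨Θ, B, hB, hΘ⟩ := exists_finset_common_direction (E := E)
  set R : ℝ := ∑ θ ∈ Θ, ‖θ‖ with hR
  have hR0 : 0 ≤ R := Finset.sum_nonneg fun _ _ => norm_nonneg _
  have hRΘ : ∀ θ ∈ Θ, ‖θ‖ ≤ R := fun θ hθ =>
    Finset.single_le_sum (f := fun θ : E => ‖θ‖) (fun _ _ => norm_nonneg _) hθ
  set M : ℝ := B * (R + 1) with hM
  have hM0 : 0 ≤ M := by positivity
  refine ⟨8 * Θ.card * (R + M) + 1, by positivity, fun N D x e r he hD hx hr => ?_⟩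
  have hD0 : 0 ≤ D := (norm_nonneg _).trans (hD N le_rfl)
  have heN : 0 ≤ e N - e 0 := sub_nonneg.2 (he (Nat.zero_le N))
  have key := sum_le_card_mul_of_forall_exists_drop (ι := Θ) (N := N)
    (a := fun i θ => ⟪(θ : E), x i⟫ - M * e i) (r := fun i => r i / 8)
    (M := R * D + M * (e N - e 0)) ?_ ?_
  · rw [← Finset.sum_div, div_le_iff₀ (by norm_num), Fintype.card_coe] at key
    have h1 : 0 ≤ (Θ.card : ℝ) * (R * (e N - e 0)) := by positivity
    have h2 : 0 ≤ (Θ.card : ℝ) * (M * D) := by positivity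
    nlinarith
  · intro i _
    obtain ⟨θ, hθ, hθV⟩ := hΘ
      {v | ∃ j, i < j ∧ j ≤ N ∧ B * (e j - e i) ≤ ‖x i - x j‖ ∧ v = x i - x j} (by
        have main : ∀ j k, i < j → j ≤ k → k ≤ N → B * (e j - e i) ≤ ‖x i - x j‖ →
            -(‖x i - x j‖ * ‖x i - x k‖) ≤ B * ⟪x i - x j, x i - x k⟫ := by
          intro j k hij hjk hk hj
          have h1 := hx i j k hij hjk hk
          have h2 := norm_sub_sq_real (x i - x j) (x i - x k)
          have h3 : ‖(x i - x j) - (x i - x k)‖ = ‖x j - x k‖ := by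
            rw [sub_sub_sub_cancel_left, norm_sub_rev]
          rw [h3] at h2
          have h4 : 0 ≤ e j - e i := sub_nonneg.2 (he hij.le)
          have h5 : e j - e i ≤ ‖x i - x j‖ := by nlinarith
          have h6 : ‖x j - x k‖ ^ 2 ≤ (‖x i - x k‖ + (e j - e i)) ^ 2 := by gcongr
          have h7 : (e j - e i) ^ 2 ≤ ‖x i - x j‖ ^ 2 := by gcongr
          have h8 : -((e j - e i) * ‖x i - x k‖) ≤ ⟪x i - x j, x i - x k⟫ := by nlinarith
          have h9 := mul_le_mul_of_nonneg_left h8 (by linarith : 0 ≤ B)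
          have h10 := mul_le_mul_of_nonneg_right hj (norm_nonneg (x i - x k))
          linarith
        rintro _ ⟨j, hij, hj, hgj, rfl⟩ _ ⟨k, hik, hk, hgk, rfl⟩
        rcases le_total j k with h | h
        · exact main j k hij h hk hgj
        · rw [mul_comm ‖x i - x j‖, real_inner_comm]
          exact main k j hik h hj hgk)
    refine ⟨⟨θ, hθ⟩, fun j hij hj => ?_⟩
    have hrj := hr i j hij hj
    have hej : 0 ≤ e j - e i := sub_nonneg.2 (he hij.le)
    suffices r i / 8 ≤ ⟪θ, x i - x j⟫ + M * (e j - e i) by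
      rw [inner_sub_right] at this
      simp only
      linarith
    by_cases hgood : B * (e j - e i) ≤ ‖x i - x j‖
    · have h1 := hθV _ ⟨j, hij, hj, hgood, rfl⟩
      have h2 : 0 ≤ M * (e j - e i) := by positivity
      linarith
    · have h1 : -(R * ‖x i - x j‖) ≤ ⟪θ, x i - x j⟫ := by
        refine le_trans ?_ (neg_le_of_abs_le (abs_real_inner_le_norm θ (x i - x j)))
        gcongr
        exact hRΘ θ hθ
      have h2 : (R + 1) * ‖x i - x j‖ ≤ M * (e j - e i) := by
        rw [hM, mul_comm B, mul_assoc]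
        gcongr
        exact (not_le.1 hgood).le
      have := norm_nonneg (x i - x j)
      linarith
  · rintro i hi ⟨θ, hθ⟩
    have h1 : ⟪θ, x i - x N⟫ ≤ R * D := (real_inner_le_norm _ _).trans
      (mul_le_mul (hRΘ θ hθ) (hD i hi) (norm_nonneg _) hR0)
    have h2 : M * (e N - e i) ≤ M * (e N - e 0) := by
      gcongr
      exact he (Nat.zero_le i)
    rw [inner_sub_right] at h1
    simp only
    linarith

end

/-- An upper bound for the partial sums of `1 / √k`. -/
lemma sum_range_one_div_sqrt_le (T : ℕ) :
    ∑ k ∈ Finset.range T, 1 / √((k + 1 : ℕ) : ℝ) ≤ 2 * √(T : ℝ) := by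
  induction T with
  | zero => simp
  | succ T ih =>
    rw [Finset.sum_range_succ]
    have h0 : 0 < √((T + 1 : ℕ) : ℝ) := Real.sqrt_pos.2 (by positivity)
    have h1 : √((T + 1 : ℕ) : ℝ) ^ 2 = T + 1 := by
      rw [Real.sq_sqrt (by positivity)]
      push_cast
      rfl
    have h2 : √(T : ℝ) ^ 2 = T := Real.sq_sqrt (by positivity)
    have h3 : 1 / √((T + 1 : ℕ) : ℝ) ≤ 2 * √((T + 1 : ℕ) : ℝ) - 2 * √(T : ℝ) := by
      rw [div_le_iff₀ h0]
      nlinarith [sq_nonneg (√((T + 1 : ℕ) : ℝ) - √(T : ℝ))]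
    linarith

/-- The variational inequality of a projection bounds the distance to points of the set. -/
lemma norm_sub_le_of_inner_sub_nonpos {E : Type*} [NormedAddCommGroup E] [InnerProductSpace ℝ E]
    {w p z : E} (h : ⟪w - p, z - p⟫ ≤ 0) : ‖p - z‖ ≤ ‖w - z‖ := by
  have h1 := norm_sub_sq_real (w - p) (z - p)
  rw [sub_sub_sub_cancel_right] at h1
  rw [norm_sub_rev p z]
  exact (sq_le_sq₀ (norm_nonneg _) (norm_nonneg _)).1 (by nlinarith [sq_nonneg ‖w - p‖])

/-- CCV bound for Nested Projected OGD with step sizes `η_t = D/(G√t)` for convex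
losses: the cumulative constraint violation is at most `C · G · (D + 2D√T)`,
with `C` depending only on the dimension `d`. -/
theorem np_ogd_ccv_convex (d : ℕ) (hd : 1 ≤ d) :
    ∃ C : ℝ, 0 < C ∧
      ∀ (T : ℕ) (D G : ℝ), 0 < D → 0 < G →
      ∀ (X : Set (EuclideanSpace ℝ (Fin d))),
        X.Nonempty → IsClosed X → Convex ℝ X →
        (∀ u ∈ X, ∀ v ∈ X, ‖u - v‖ ≤ D) →
      ∀ (g : ℕ → EuclideanSpace ℝ (Fin d) → ℝ),
        (∀ t, 1 ≤ t → t ≤ T → ∀ u ∈ X, ∀ v ∈ X, |g t u - g t v| ≤ G * ‖u - v‖) →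
        (∀ t, 1 ≤ t → t ≤ T → Convex ℝ {y : EuclideanSpace ℝ (Fin d) | g t y ≤ 0}) →
      ∀ (S : ℕ → Set (EuclideanSpace ℝ (Fin d))),
        S 0 = X →
        (∀ t, 1 ≤ t → t ≤ T → S t = S (t - 1) ∩ {y ∈ X | g t y ≤ 0}) →
        (S T).Nonempty →
      ∀ (h x : ℕ → EuclideanSpace ℝ (Fin d)),
        (∀ t, 1 ≤ t → t ≤ T → ‖h t‖ ≤ G) →
        x 1 ∈ X →
        (∀ t, 1 ≤ t → t ≤ T → x (t + 1) ∈ S t ∧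
          ∀ y ∈ S t, ⟪(x t - (D / (G * Real.sqrt t)) • h t) - x (t + 1),
            y - x (t + 1)⟫ ≤ 0) →
        ∑ t ∈ Finset.Icc 1 T, max (g t (x t)) 0 ≤
          C * G * (D + 2 * D * Real.sqrt T) := by
  obtain ⟨C, hC, hCb⟩ := exists_sum_le_of_perturbed_selfContracted (E := EuclideanSpace ℝ (Fin d))
  refine ⟨C, hC, fun T D G hD hG X _ _ _ hdiam g hg _ S hS0 hS _ h x hh hx1 hx => ?_⟩
  have hanti : ∀ s t, s ≤ t → t ≤ T → S t ⊆ S s := by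
    intro s t hst
    induction t, hst using Nat.le_induction with
    | base => exact fun _ => subset_rfl
    | succ t hst ih =>
      intro ht
      rw [hS (t + 1) (by omega) ht, Nat.add_sub_cancel]
      exact Set.inter_subset_left.trans (ih (by omega))
  have hSX : ∀ t ≤ T, S t ⊆ X := fun t ht => hS0 ▸ hanti 0 t (Nat.zero_le t) ht
  have hxS : ∀ i j, i < j → j ≤ T → x (j + 1) ∈ S (i + 1) := fun i j hij hj =>
    hanti (i + 1) j hij hj (hx j (by omega) hj).1
  have hxX : ∀ i ≤ T, x (i + 1) ∈ X := by
    intro i hi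
    rcases Nat.eq_zero_or_pos i with rfl | hi0
    · exact hx1
    · exact hSX i hi (hx i hi0 hi).1
  set e : ℕ → ℝ := fun i => ∑ k ∈ Finset.range i, D / √((k + 1 : ℕ) : ℝ) with he
  have hstep : ∀ i k, i < k → k ≤ T →
      ‖x (i + 1 + 1) - x (k + 1)‖ ≤ ‖x (i + 1) - x (k + 1)‖ + D / √((i + 1 : ℕ) : ℝ) := by
    intro i k hik hk
    have h1 := norm_sub_le_of_inner_sub_nonpos
      ((hx (i + 1) (by omega) (by omega)).2 _ (hxS i k hik hk))
    refine h1.trans ?_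
    rw [sub_right_comm]
    refine (norm_sub_le _ _).trans ?_
    gcongr
    have hs : 0 < √((i + 1 : ℕ) : ℝ) := Real.sqrt_pos.2 (by positivity)
    rw [norm_smul, Real.norm_of_nonneg (by positivity)]
    calc D / (G * √((i + 1 : ℕ) : ℝ)) * ‖h (i + 1)‖
        ≤ D / (G * √((i + 1 : ℕ) : ℝ)) * G := by
          gcongr
          exact hh _ (by omega) (by omega)
      _ = D / √((i + 1 : ℕ) : ℝ) := by field_simp
  have hbound := hCb T D (fun i => x (i + 1)) e (fun i => max (g (i + 1) (x (i + 1))) 0 / G)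
    (monotone_nat_of_le_succ fun n => by
      rw [he]
      simp only [Finset.sum_range_succ]
      exact le_add_of_nonneg_right (by positivity))
    (fun i hi => hdiam _ (hxX i hi) _ (hxX T le_rfl))
    (by
      intro i j k hij hjk hk
      induction j, hij using Nat.le_induction with
      | base =>
        have := hstep i k hjk hk
        simp only [he, Finset.sum_range_succ]
        linarith
      | succ j hij ih =>
        have h1 := ih (by omega)
        have h2 := hstep j k hjk hk
        simp only [he, Finset.sum_range_succ] at h1 ⊢
        linarith)
    (by
      intro i j hij hj
      have hmem := hxS i j hij hj
      have hgj : g (i + 1) (x (j + 1)) ≤ 0 := by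
        rw [hS (i + 1) (by omega) (by omega)] at hmem
        exact hmem.2.2
      have hl := hg (i + 1) (by omega) (by omega) _ (hxX i (by omega)) _ (hxX j hj)
      rw [div_le_iff₀ hG, mul_comm]
      refine max_le ?_ (by positivity)
      linarith [le_abs_self (g (i + 1) (x (i + 1)) - g (i + 1) (x (j + 1)))])
  have hsum : ∑ t ∈ Finset.Icc 1 T, max (g t (x t)) 0 =
      ∑ i ∈ Finset.range T, max (g (i + 1) (x (i + 1))) 0 := by
    rw [Finset.range_eq_Ico, Finset.sum_Ico_add' (fun t => max (g t (x t)) 0) 0 T 1]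
    rfl
  have heT : e T - e 0 ≤ 2 * D * √(T : ℝ) := by
    have h1 := mul_le_mul_of_nonneg_left (sum_range_one_div_sqrt_le T) hD.le
    rw [Finset.mul_sum] at h1
    simp only [mul_one_div] at h1
    simp only [he, Finset.range_zero, Finset.sum_empty]
    linarith
  rw [← Finset.sum_div, div_le_iff₀ hG] at hbound
  rw [hsum]
  refine hbound.trans ?_
  rw [mul_right_comm]
  gcongr
end

section
/- Fix a dimension d ≥ 1. There exists a constant C > 0 depending only on d such that the following holds. Let 𝒳 ⊆ ℝ^d be a nonempty closed convex set of diameter at most D, and let G > 0, μ > 0. For t = 1, …, T, let g_t : ℝ^d → ℝ be G-Lipschitz on 𝒳 with convex sublevel set {x : g_t(x) ≤ 0}, define S_0 = 𝒳 and S_t = S_{t−1} ∩ {x ∈ 𝒳 : g_t(x) ≤ 0}, and assume S_T ≠ ∅. Let h_1, …, h_T ∈ ℝ^d with ‖h_t‖ ≤ G, and run Nested Projected OGD with step sizes η_t = 1/(μt): x_1 ∈ 𝒳 and x_{t+1} = Π_{S_t}(x_t − η_t h_t). Then the cumulative constraint violation satisfies Σ_{t=1}^{T} max(g_t(x_t),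 0) ≤ C · G · (D + (G/μ)(1 + log T)). -/
open scoped RealInnerProductSpace

/-- Finitely many unit vectors whose pairwise inner products are almost nonnegative have
inner product bounded below with a common vector of norm at most one. -/
theorem exists_inner_ge_of_pairwise_inner_ge (d : ℕ) (U : Set (EuclideanSpace ℝ (Fin d)))
    (hfin : U.Finite) (hunit : ∀ w ∈ U, ‖w‖ = 1)
    (hpair : ∀ w ∈ U, ∀ w' ∈ U, -(1 / (2 * ((d : ℝ) + 1))) ≤ ⟪w, w'⟫) :
    ∃ m : EuclideanSpace ℝ (Fin d), ‖m‖ ≤ 1 ∧ ∀ w ∈ U, 1 / (2 * ((d : ℝ) + 1)) ≤ ⟪m, w⟫ := by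
  rcases U.eq_empty_or_nonempty with rfl | hne
  · exact ⟨0, by simp, by simp⟩
  set δ : ℝ := 1 / (2 * ((d : ℝ) + 1)) with hδ
  have hδ0 : 0 < δ := by positivity
  have hconv : Convex ℝ (convexHull ℝ U) := convex_convexHull ℝ U
  have hcomp : IsCompact (convexHull ℝ U) := hfin.isCompact_convexHull ℝ
  obtain ⟨m, hm, hmin⟩ := exists_norm_eq_iInf_of_complete_convex hne.convexHull
    hcomp.isComplete hconv 0
  have hvi := (norm_eq_iInf_iff_real_inner_le_zero hconv hm).1 hmin
  have hge : ∀ w ∈ U, ‖m‖ ^ 2 ≤ ⟪m, w⟫ := by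
    intro w hw
    have := hvi w (subset_convexHull ℝ U hw)
    rw [zero_sub, inner_neg_left, inner_sub_right, real_inner_self_eq_norm_sq] at this
    linarith
  have hle : ‖m‖ ≤ 1 := by
    obtain ⟨w, hw⟩ := hne
    have h1 := hge w hw
    have h2 := real_inner_le_norm m w
    rw [hunit w hw] at h2
    nlinarith [norm_nonneg m]
  refine ⟨m, hle, fun w hw => le_trans ?_ (hge w hw)⟩
  obtain ⟨ι, _, z, l, hz, haff, hl, hsum, hcomb⟩ := eq_pos_convex_span_of_mem_convexHull hm
  have hcard : (Fintype.card ι : ℝ) ≤ (d : ℝ) + 1 := by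
    have h1 := haff.card_le_finrank_succ
    have h2 := Submodule.finrank_le (vectorSpan ℝ (Set.range z))
    rw [finrank_euclideanSpace_fin] at h2
    exact_mod_cast h1.trans (by omega)
  have hcs : 1 ≤ ((d : ℝ) + 1) * ∑ i, l i ^ 2 := by
    have h1 := sq_sum_le_card_mul_sum_sq (s := (Finset.univ : Finset ι)) (f := l)
    rw [hsum, one_pow, Finset.card_univ] at h1
    exact h1.trans (mul_le_mul_of_nonneg_right hcard
      (Finset.sum_nonneg fun i _ => sq_nonneg _))
  have hzU : ∀ i, z i ∈ U := fun i => hz ⟨i, rfl⟩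
  have hexp : ‖m‖ ^ 2 = ∑ i, ∑ j, l i * (l j * ⟪z i, z j⟫) := by
    rw [← real_inner_self_eq_norm_sq, ← hcomb, sum_inner]
    simp_rw [inner_sum, real_inner_smul_left, real_inner_smul_right]
  have hlow : ∑ i, l i ^ 2 - δ ≤ ‖m‖ ^ 2 := by
    classical
    have h1 : ∑ i, ∑ j, l i * (l j * ((if i = j then 1 else 0) - δ)) = ∑ i, l i ^ 2 - δ := by
      have : ∀ i, ∑ j, l i * (l j * ((if i = j then 1 else 0) - δ)) = l i ^ 2 - l i * δ := by
        intro i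
        rw [← Finset.mul_sum]
        simp_rw [mul_sub]
        rw [Finset.sum_sub_distrib, ← Finset.sum_mul, hsum]
        simp
        ring
      simp_rw [this]
      rw [Finset.sum_sub_distrib, ← Finset.sum_mul, hsum, one_mul]
    rw [hexp, ← h1]
    refine Finset.sum_le_sum fun i _ => Finset.sum_le_sum fun j _ => ?_
    refine mul_le_mul_of_nonneg_left (mul_le_mul_of_nonneg_left ?_ (hl j).le) (hl i).le
    split_ifs with hij
    · subst hij
      rw [real_inner_self_eq_norm_sq, hunit _ (hzU i)]
      linarith
    · have := hpair _ (hzU i) _ (hzU j)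
      linarith
  have h2 : 2 * δ ≤ ∑ i, l i ^ 2 := by
    have : 2 * δ = 1 / ((d : ℝ) + 1) := by rw [hδ]; field_simp
    rw [this, div_le_iff₀ (by positivity)]
    linarith
  linarith

/-- A sum of drops is controlled by the total variation of finitely many tail maxima. -/
theorem sum_le_of_exists_drop {ι : Type*} (N : Finset ι) (f : ι → ℕ → ℝ) (q : ℕ → ℝ) (A B : ι → ℝ)
    (n : ℕ)
    (hA : ∀ u ∈ N, ∀ s, s ≤ n → f u s ≤ A u) (hB : ∀ u ∈ N, B u ≤ f u n)
    (hdrop : ∀ t, t < n → ∃ u ∈ N, ∀ s, t < s → s ≤ n → f u s + q t ≤ f u t) :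
    ∑ t ∈ Finset.range n, q t ≤ ∑ u ∈ N, (A u - B u) := by
  classical
  have key : ∀ k, k ≤ n → ∀ b : ι → ℝ, (∀ u ∈ N, ∀ s, n - k ≤ s → s ≤ n → f u s ≤ b u) →
      ∑ t ∈ Finset.Ico (n - k) n, q t ≤ ∑ u ∈ N, (b u - B u) := by
    intro k
    induction k with
    | zero =>
      intro _ b hb
      simp only [Nat.sub_zero, Finset.Ico_self, Finset.sum_empty]
      exact Finset.sum_nonneg fun u hu => by
        have := hb u hu n (by omega) le_rfl
        linarith [hB u hu]
    | succ k ih =>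
      intro hk b hb
      have hlt : n - (k + 1) < n := by omega
      obtain ⟨u₀, hu₀, hd⟩ := hdrop _ hlt
      have h1 := ih (by omega) (fun u => if u = u₀ then b u - q (n - (k + 1)) else b u) (by
        intro u hu s hs hsn
        split_ifs with h
        · subst h
          have h2 := hd s (by omega) hsn
          have h3 := hb u hu (n - (k + 1)) le_rfl hlt.le
          linarith
        · exact hb u hu s (by omega) hsn)
      rw [← Finset.insert_Ico_add_one_left_eq_Ico hlt, Finset.sum_insert (by simp),
        show n - (k + 1) + 1 = n - k by omega]
      have h4 : ∑ u ∈ N, ((if u = u₀ then b u - q (n - (k + 1)) else b u) - B u) =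
          ∑ u ∈ N, (b u - B u) - q (n - (k + 1)) := by
        have : ∀ u, ((if u = u₀ then b u - q (n - (k + 1)) else b u) - B u) =
            (b u - B u) - (if u = u₀ then q (n - (k + 1)) else 0) := by
          intro u; split_ifs <;> ring
        simp_rw [this]
        rw [Finset.sum_sub_distrib, Finset.sum_ite_eq' N u₀, if_pos hu₀]
      linarith
  have := key n le_rfl A (fun u hu s _ hs => hA u hu s hs)
  simpa using this

/-- Accumulated form of an approximate contraction towards a fixed later point. -/
theorem norm_sub_le_add_sum_of_step {E : Type*} [NormedAddCommGroup E] (y : ℕ → E) (e : ℕ → ℝ)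
    (p : E) (t s : ℕ) (hts : t ≤ s)
    (hstep : ∀ k, t ≤ k → k < s → ‖y (k + 1) - p‖ ≤ ‖y k - p‖ + e k) :
    ‖y s - p‖ ≤ ‖y t - p‖ + (∑ i ∈ Finset.range s, e i - ∑ i ∈ Finset.range t, e i) := by
  induction s, hts using Nat.le_induction with
  | base => simp
  | succ s hs ih =>
    have h1 := ih fun k hk hks => hstep k hk (by omega)
    have h2 := hstep s hs (by omega)
    rw [Finset.sum_range_succ]
    linarith

/-- If passing from `0` to `a` increases the distance to `b` by at most a small multiple of `‖a‖`,
the angle between `a` and `b` is almost non-obtuse. -/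
theorem neg_mul_norm_le_inner_of_norm_sub_le {E : Type*} [NormedAddCommGroup E]
    [InnerProductSpace ℝ E] (a b : E) {δ ε : ℝ} (hδ1 : δ ≤ 1) (hε : 0 ≤ ε)
    (hεa : ε ≤ δ * ‖a‖) (hab : ‖a - b‖ ≤ ‖b‖ + ε) :
    -δ * (‖a‖ * ‖b‖) ≤ ⟪a, b⟫ := by
  have h1 := norm_sub_sq_real a b
  have h2 : ‖a - b‖ ^ 2 ≤ (‖b‖ + ε) ^ 2 := by gcongr
  have h3 : ε * ‖b‖ ≤ δ * ‖a‖ * ‖b‖ := by gcongr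
  have h4 : ε ≤ ‖a‖ := hεa.trans (mul_le_of_le_one_left (norm_nonneg _) hδ1)
  have h5 : ε ^ 2 ≤ ‖a‖ ^ 2 := by gcongr
  nlinarith

/-- Robust length bound for approximately self-contracted sequences: if each step increases the
distance to every later point by at most `e k`, then quantities `r k` bounded by the distance from
`y k` to all later points are summable with a dimensional constant. -/
theorem exists_sum_le_of_approx_self_contracted (d : ℕ) :
    ∃ C : ℝ, 0 < C ∧ ∀ (n : ℕ) (D : ℝ) (y : ℕ → EuclideanSpace ℝ (Fin d)) (e r : ℕ → ℝ),
      0 ≤ D → (∀ k, 0 ≤ e k) →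
      (∀ k s, k < s → s ≤ n → ‖y (k + 1) - y s‖ ≤ ‖y k - y s‖ + e k) →
      (∀ k s, k < s → s ≤ n → r k ≤ ‖y k - y s‖) →
      (∀ s, s ≤ n → ‖y 0 - y s‖ ≤ D) →
      ∑ k ∈ Finset.range n, r k ≤ C * (D + ∑ k ∈ Finset.range n, e k) := by
  set δ : ℝ := 1 / (2 * ((d : ℝ) + 1)) with hδ
  have hδ0 : 0 < δ := by positivity
  have hδ1 : δ ≤ 1 / 2 := by
    rw [hδ]
    apply one_div_le_one_div_of_le (by norm_num)
    have : (0 : ℝ) ≤ d := Nat.cast_nonneg d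
    linarith
  obtain ⟨N', hN', hN'fin, hcover⟩ := (isCompact_closedBall
    (0 : EuclideanSpace ℝ (Fin d)) 1).finite_cover_balls (half_pos hδ0)
  obtain ⟨N, rfl⟩ := hN'fin.exists_finset_coe
  have hNnorm : ∀ u ∈ N, ‖u‖ ≤ 1 := fun u hu => by simpa using hN' hu
  refine ⟨(2 / δ) * ((N.card : ℝ) * (2 + 2 / δ) + 1), by positivity, ?_⟩
  intro n D y e r hD he hstep hdist hdiam
  set E : ℕ → ℝ := fun t => ∑ i ∈ Finset.range t, e i with hE
  have hEmono : Monotone E := by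
    intro a b hab
    exact Finset.sum_le_sum_of_subset_of_nonneg (Finset.range_mono hab) fun i _ _ => he i
  have hE0 : ∀ t, 0 ≤ E t := fun t => Finset.sum_nonneg fun i _ => he i
  have hinner : ∀ u ∈ N, ∀ w : EuclideanSpace ℝ (Fin d), |⟪u, w⟫| ≤ ‖w‖ := fun u hu w =>
    (abs_real_inner_le_norm u w).trans (mul_le_of_le_one_left (norm_nonneg _) (hNnorm u hu))
  have hmain := sum_le_of_exists_drop N (fun u s => ⟪u, y s⟫ - 2 / δ * E s)
    (fun t => δ / 2 * r t) (fun u => ⟪u, y 0⟫ + D) (fun u => ⟪u, y 0⟫ - D - 2 / δ * E n) n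
    (by
      intro u hu s hs
      have h1 := (abs_le.1 (hinner u hu (y 0 - y s))).1
      rw [inner_sub_right] at h1
      have h2 : 0 ≤ 2 / δ * E s := mul_nonneg (by positivity) (hE0 s)
      have h3 := hdiam s hs
      linarith)
    (by
      intro u hu
      have h1 := (abs_le.1 (hinner u hu (y 0 - y n))).2
      rw [inner_sub_right] at h1
      have h3 := hdiam n le_rfl
      linarith)
    (by
      intro t ht
      set w : ℕ → EuclideanSpace ℝ (Fin d) := fun s => y s - y t with hw
      set good : Set ℕ := {s | t < s ∧ s ≤ n ∧ E s - E t < δ * ‖w s‖} with hgood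
      have hgoodfin : good.Finite := (Set.finite_Iic n).subset fun s hs => hs.2.1
      have hpos : ∀ s ∈ good, 0 < ‖w s‖ := by
        intro s hs
        have h1 := hEmono hs.1.le
        have h2 := hs.2.2
        by_contra hc
        have : ‖w s‖ = 0 := le_antisymm (not_lt.1 hc) (norm_nonneg _)
        rw [this, mul_zero] at h2
        linarith
      have hpair : ∀ s ∈ good, ∀ s' ∈ good, s ≤ s' →
          -δ * (‖w s‖ * ‖w s'‖) ≤ ⟪w s, w s'⟫ := by
        intro s hs s' hs' hss
        refine neg_mul_norm_le_inner_of_norm_sub_le _ _ (by linarith)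
          (sub_nonneg.2 (hEmono hs.1.le)) hs.2.2.le ?_
        have h1 := norm_sub_le_add_sum_of_step y e (y s') t s hs.1.le
          fun k _ hks => hstep k s' (by omega) hs'.2.1
        rw [norm_sub_rev (y t)] at h1
        simpa [hw, hE] using h1
      obtain ⟨m, hm, hmw⟩ := exists_inner_ge_of_pairwise_inner_ge d
        ((fun s => (‖w s‖)⁻¹ • w s) '' good) (hgoodfin.image _)
        (by
          rintro _ ⟨s, hs, rfl⟩
          have := hpos s hs
          simp [norm_smul, this.ne'])
        (by
          rintro _ ⟨s, hs, rfl⟩ _ ⟨s', hs', rfl⟩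
          have h1 := hpos s hs
          have h2 := hpos s' hs'
          have h3 : -δ * (‖w s‖ * ‖w s'‖) ≤ ⟪w s, w s'⟫ := by
            rcases le_total s s' with h | h
            · exact hpair s hs s' hs' h
            · rw [real_inner_comm, mul_comm ‖w s‖]
              exact hpair s' hs' s hs h
          rw [← hδ]
          dsimp only
          rw [real_inner_smul_left, real_inner_smul_right, ← mul_assoc, ← mul_inv,
            inv_mul_eq_div, le_div_iff₀ (by positivity)]
          exact h3)
      have hmem : -m ∈ Metric.closedBall (0 : EuclideanSpace ℝ (Fin d)) 1 := by simpa using hm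
      obtain ⟨u, hu, hum⟩ := Set.mem_iUnion₂.1 (hcover hmem)
      rw [Metric.mem_ball, dist_eq_norm] at hum
      refine ⟨u, hu, fun s hts hsn => ?_⟩
      have hrs : r t ≤ ‖w s‖ := by
        rw [hw]
        dsimp only
        rw [norm_sub_rev]
        exact hdist t s hts hsn
      have hEs := hEmono hts.le
      have hsplit : ⟪u, y s⟫ = ⟪u, y t⟫ + ⟪u, w s⟫ := by
        rw [← inner_add_right, hw]; simp
      have hEdist : 0 ≤ 2 / δ * (E s - E t) := mul_nonneg (by positivity) (sub_nonneg.2 hEs)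
      have hrδ : δ / 2 * r t ≤ δ / 2 * ‖w s‖ := by gcongr
      by_cases hs : E s - E t < δ * ‖w s‖
      · have hsg : s ∈ good := ⟨hts, hsn, hs⟩
        have h0 := hpos s hsg
        have h1 := hmw _ ⟨s, hsg, rfl⟩
        dsimp only at h1
        rw [← hδ, real_inner_smul_right, inv_mul_eq_div, le_div_iff₀ h0] at h1
        have h2 := (abs_le.1 (abs_real_inner_le_norm (-m - u) (w s))).1
        have h3 : ‖-m - u‖ * ‖w s‖ ≤ δ / 2 * ‖w s‖ := by gcongr
        rw [inner_sub_left, inner_neg_left] at h2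
        linarith
      · have h1 : 2 * ‖w s‖ ≤ 2 / δ * (E s - E t) := by
          have : 2 * ‖w s‖ = 2 / δ * (δ * ‖w s‖) := by field_simp
          rw [this]
          exact mul_le_mul_of_nonneg_left (not_lt.1 hs) (by positivity)
        have h2 := (abs_le.1 (hinner u hu (w s))).2
        have h3 : δ / 2 * ‖w s‖ ≤ ‖w s‖ :=
          mul_le_of_le_one_left (norm_nonneg _) (by linarith)
        linarith)
  rw [← Finset.mul_sum] at hmain
  have hconst : ∑ u ∈ N, ((⟪u, y 0⟫ + D) - (⟪u, y 0⟫ - D - 2 / δ * E n)) =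
      (N.card : ℝ) * (2 * D + 2 / δ * E n) := by
    rw [Finset.sum_congr rfl fun u _ => show ((⟪u, y 0⟫ + D) - (⟪u, y 0⟫ - D - 2 / δ * E n)) =
      2 * D + 2 / δ * E n by ring, Finset.sum_const, nsmul_eq_mul]
  rw [hconst] at hmain
  have h1 : (N.card : ℝ) * (2 * D + 2 / δ * E n) ≤
      ((N.card : ℝ) * (2 + 2 / δ) + 1) * (D + E n) := by
    have hc : (0 : ℝ) ≤ N.card := Nat.cast_nonneg _
    have h2 : 2 * D + 2 / δ * E n ≤ (2 + 2 / δ) * (D + E n) := by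
      have : 0 ≤ 2 / δ * D := by positivity
      nlinarith [hE0 n]
    have h3 := mul_le_mul_of_nonneg_left h2 hc
    nlinarith [hE0 n]
  calc ∑ k ∈ Finset.range n, r k = 2 / δ * (δ / 2 * ∑ k ∈ Finset.range n, r k) := by
        field_simp
    _ ≤ 2 / δ * (((N.card : ℝ) * (2 + 2 / δ) + 1) * (D + E n)) :=
        mul_le_mul_of_nonneg_left (hmain.trans h1) (by positivity)
    _ = _ := by ring

/-- The variational inequality for a projection `p` of `z` bounds distances to points of the
set. -/
theorem norm_sub_le_of_inner_le_zero {E : Type*} [NormedAddCommGroup E] [InnerProductSpace ℝ E]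
    {z p q : E} (h : ⟪z - p, q - p⟫ ≤ 0) : ‖p - q‖ ≤ ‖z - q‖ := by
  have h1 := norm_sub_sq_real (z - p) (q - p)
  rw [sub_sub_sub_cancel_right, norm_sub_rev q p] at h1
  exact le_of_sq_le_sq (by nlinarith [sq_nonneg ‖z - p‖]) (norm_nonneg _)

/-- CCV bound for Nested Projected OGD with step sizes `η_t = 1/(μt)` for strongly
convex losses: the cumulative constraint violation is at most
`C · G · (D + (G/μ)(1 + log T))`, with `C` depending only on the dimension `d`. -/
theorem np_ogd_ccv_strongly_convex (d : ℕ) (hd : 1 ≤ d) :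
    ∃ C : ℝ, 0 < C ∧
      ∀ (T : ℕ) (D G μ : ℝ), 0 ≤ D → 0 < G → 0 < μ →
      ∀ (X : Set (EuclideanSpace ℝ (Fin d))),
        X.Nonempty → IsClosed X → Convex ℝ X →
        (∀ u ∈ X, ∀ v ∈ X, ‖u - v‖ ≤ D) →
      ∀ (g : ℕ → EuclideanSpace ℝ (Fin d) → ℝ),
        (∀ t, 1 ≤ t → t ≤ T → ∀ u ∈ X, ∀ v ∈ X, |g t u - g t v| ≤ G * ‖u - v‖) →
        (∀ t, 1 ≤ t → t ≤ T → Convex ℝ {y : EuclideanSpace ℝ (Fin d) | g t y ≤ 0}) →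
      ∀ (S : ℕ → Set (EuclideanSpace ℝ (Fin d))),
        S 0 = X →
        (∀ t, 1 ≤ t → t ≤ T → S t = S (t - 1) ∩ {y ∈ X | g t y ≤ 0}) →
        (S T).Nonempty →
      ∀ (h x : ℕ → EuclideanSpace ℝ (Fin d)),
        (∀ t, 1 ≤ t → t ≤ T → ‖h t‖ ≤ G) →
        x 1 ∈ X →
        (∀ t, 1 ≤ t → t ≤ T → x (t + 1) ∈ S t ∧
          ∀ y ∈ S t, ⟪(x t - (1 / (μ * t)) • h t) - x (t + 1),
            y - x (t + 1)⟫ ≤ 0) →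
        ∑ t ∈ Finset.Icc 1 T, max (g t (x t)) 0 ≤
          C * G * (D + G / μ * (1 + Real.log T)) := by
  obtain ⟨C, hC, hbound⟩ := exists_sum_le_of_approx_self_contracted d
  refine ⟨C, hC, ?_⟩
  intro T D G μ hD hG hμ X _ _ _ hdiam g hg _ S hS0 hS _ h x hh hx1 hproj
  have hanti : ∀ s, s ≤ T → ∀ t, t ≤ s → S s ⊆ S t := by
    intro s
    induction s with
    | zero => intro _ t ht; rw [Nat.le_zero.1 ht]
    | succ s ih =>
      intro hs t ht
      rcases Nat.lt_or_ge t (s + 1) with h1 | h1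
      · refine subset_trans ?_ (ih (by omega) t (by omega))
        rw [hS (s + 1) (by omega) hs]
        exact Set.inter_subset_left
      · rw [le_antisymm ht h1]
  have hxS : ∀ s, s ≤ T → x (s + 1) ∈ S s := by
    intro s hs
    rcases Nat.eq_zero_or_pos s with rfl | hpos
    · rw [hS0]; exact hx1
    · exact (hproj s hpos hs).1
  have hxX : ∀ s, s ≤ T → x (s + 1) ∈ X := fun s hs =>
    hS0 ▸ hanti s hs 0 (Nat.zero_le s) (hxS s hs)
  have key := hbound T D (fun k => x (k + 1)) (fun k => G / μ * ((k : ℝ) + 1)⁻¹)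
    (fun k => max (g (k + 1) (x (k + 1))) 0 / G) hD (fun k => by positivity)
    (by
      intro k s hks hs
      have h1 := norm_sub_le_of_inner_le_zero ((hproj (k + 1) (by omega) (by omega)).2
        (x (s + 1)) (hanti s hs (k + 1) hks (hxS s hs)))
      refine h1.trans ?_
      rw [sub_right_comm]
      refine (norm_sub_le _ _).trans (add_le_add_right ?_ _)
      have hpos : 0 < 1 / (μ * ((k + 1 : ℕ) : ℝ)) := by positivity
      rw [norm_smul, Real.norm_of_nonneg hpos.le]
      calc 1 / (μ * ((k + 1 : ℕ) : ℝ)) * ‖h (k + 1)‖ ≤ 1 / (μ * ((k + 1 : ℕ) : ℝ)) * G :=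
            mul_le_mul_of_nonneg_left (hh _ (by omega) (by omega)) hpos.le
        _ = G / μ * ((k : ℝ) + 1)⁻¹ := by push_cast; field_simp)
    (by
      intro k s hks hs
      rw [div_le_iff₀ hG, mul_comm]
      have hmem := hanti s hs (k + 1) hks (hxS s hs)
      rw [hS (k + 1) (by omega) (by omega)] at hmem
      have hlip := (abs_le.1 (hg (k + 1) (by omega) (by omega) _ (hxX k (by omega)) _
        (hxX s hs))).2
      have hle : g (k + 1) (x (s + 1)) ≤ 0 := hmem.2.2
      exact max_le (by linarith) (by positivity))
    (fun s hs => hdiam _ (hxX 0 (by omega)) _ (hxX s hs))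
  rw [← Finset.sum_div, div_le_iff₀ hG, ← Finset.mul_sum] at key
  have hharm : ∑ k ∈ Finset.range T, ((k : ℝ) + 1)⁻¹ ≤ 1 + Real.log T := by
    have := harmonic_le_one_add_log T
    rw [harmonic] at this
    push_cast at this
    exact this
  have hsum : ∑ t ∈ Finset.Icc 1 T, max (g t (x t)) 0 =
      ∑ k ∈ Finset.range T, max (g (k + 1) (x (k + 1))) 0 := by
    rw [← Finset.Ico_add_one_right_eq_Icc, Finset.sum_Ico_eq_sum_range]
    simp [add_comm]
  rw [hsum]
  calc _ ≤ C * (D + G / μ * ∑ k ∈ Finset.range T, ((k : ℝ) + 1)⁻¹) * G := key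
    _ ≤ C * (D + G / μ * (1 + Real.log T)) * G := by gcongr
    _ = _ := by ring
end
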